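/- arXiv:2604.04581 — 5 statements merged into one kernel-verified Lean document; each statement's English description precedes it below -/
import Mathlib

section
/- For every natural number K ≥ 1 there exists N(K) ∈ ℕ such that for every ring R and every finite K-approximate subring X ⊆ R there exists a finite (K^510 + K^22)-approximate subring Y ⊆ 4X + X·4X which is N(K)-commensurable with X and such that the subring ⟨Y⟩ generated by Y has a two-sided ideal J of finite additive index in ⟨Y⟩ which is ⌊4·log₂ K⌋-nilpotent (in particular, J is nilpotent of class at most ⌊4·log₂ K⌋). -/
open Pointwise

universe u

/-- A subset of a ring is additively symmetric if it contains `0` and equals its negation. -/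
def AddSymm {R : Type u} [NonUnitalRing R] (X : Set R) : Prop :=
  (0 : R) ∈ X ∧ X = -X

/-- `X` is a `K`-approximate subring: it is additively symmetric and `X·X ∪ (X+X)` is covered
by at most `K` additive translates of `X`. -/
def IsApproxSubringWith {R : Type u} [NonUnitalRing R] (K : ℕ) (X : Set R) : Prop :=
  AddSymm X ∧ ∃ F : Finset R, F.card ≤ K ∧ (X * X) ∪ (X + X) ⊆ (F : Set R) + X

/-- `A` and `B` are `N`-commensurable: each is covered by at most `N` additive translates
of the other. -/
def NCommensurable {R : Type u} [NonUnitalRing R] (N : ℕ) (A B : Set R) : Prop :=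
  (∃ F : Finset R, F.card ≤ N ∧ A ⊆ (F : Set R) + B) ∧
  (∃ G : Finset R, G.card ≤ N ∧ B ⊆ (G : Set R) + A)

/-- `mulIter S n` is the set of (left-nested) products of `n+1` elements of `S`. -/
def mulIter {R : Type u} [NonUnitalRing R] (S : Set R) : ℕ → Set R
  | 0 => S
  | n + 1 => mulIter S n * S

/-- `I` is a two-sided ideal of the subring `S` (both given as sets). -/
def IsTwoSidedIdealIn {R : Type u} [NonUnitalRing R] (I S : Set R) : Prop :=
  I ⊆ S ∧ (0 : R) ∈ I ∧ (∀ x ∈ I, ∀ y ∈ I, x + y ∈ I) ∧ (∀ x ∈ I, -x ∈ I) ∧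
    ∀ r ∈ S, ∀ x ∈ I, r * x ∈ I ∧ x * r ∈ I

/-- `J` is `n`-nilpotent: it has a nilpotent base `u₁, …, u_n`, i.e. a generating tuple with
`u_i·u_j, u_j·u_i` in the subring generated by `u₁, …, u_{i-1}` for all `i ≤ j`. -/
def IsNNilpotentSet {R : Type u} [NonUnitalRing R] (n : ℕ) (J : Set R) : Prop :=
  ∃ u : Fin n → R, (NonUnitalSubring.closure (Set.range u) : Set R) = J ∧
    ∀ i j : Fin n, i ≤ j →
      u i * u j ∈ NonUnitalSubring.closure (u '' {k : Fin n | k < i}) ∧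
      u j * u i ∈ NonUnitalSubring.closure (u '' {k : Fin n | k < i})


/-! ### Iterated sumsets and coverings -/

/-- `nsum S n` is the `n`-fold sumset of `S`. -/
def nsum {G : Type u} [AddCommGroup G] (S : Set G) : ℕ → Set G
  | 0 => {0}
  | n + 1 => nsum S n + S

/-- `A` is covered by at most `N` translates of `B`. -/
def Cov {G : Type u} [AddCommGroup G] (N : ℕ) (A B : Set G) : Prop :=
  ∃ F : Finset G, F.card ≤ N ∧ ∀ a ∈ A, ∃ f ∈ F, a - f ∈ B

section cov
variable {G : Type u} [AddCommGroup G]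

lemma cov_iff {N : ℕ} {A B : Set G} :
    Cov N A B ↔ ∃ F : Finset G, F.card ≤ N ∧ A ⊆ (F : Set G) + B := by
  constructor
  · rintro ⟨F, hF, h⟩
    refine ⟨F, hF, fun a ha => ?_⟩
    obtain ⟨f, hf, hb⟩ := h a ha
    exact Set.mem_add.2 ⟨f, hf, a - f, hb, by abel⟩
  · rintro ⟨F, hF, h⟩
    refine ⟨F, hF, fun a ha => ?_⟩
    obtain ⟨f, hf, b, hb, rfl⟩ := Set.mem_add.1 (h ha)
    exact ⟨f, hf, by simpa using hb⟩

lemma Cov.mono {N N' : ℕ} {A A' B B' : Set G} (h : Cov N A B) (hN : N ≤ N') (hA : A' ⊆ A)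
    (hB : B ⊆ B') : Cov N' A' B' := by
  obtain ⟨F, hF, h⟩ := h
  refine ⟨F, hF.trans hN, fun a ha => ?_⟩
  obtain ⟨f, hf, hb⟩ := h a (hA ha)
  exact ⟨f, hf, hB hb⟩

lemma Cov.refl (A : Set G) : Cov 1 A A :=
  ⟨{0}, by simp, fun a ha => ⟨0, by simp, by simpa using ha⟩⟩

lemma Cov.trans {N M : ℕ} {A B C : Set G} (h : Cov N A B) (h' : Cov M B C) :
    Cov (N * M) A C := by
  classical
  obtain ⟨F, hF, h⟩ := h
  obtain ⟨F', hF', h'⟩ := h'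
  refine ⟨F + F', Finset.card_add_le.trans (Nat.mul_le_mul hF hF'), fun a ha => ?_⟩
  obtain ⟨f, hf, hb⟩ := h a ha
  obtain ⟨f', hf', hc⟩ := h' _ hb
  exact ⟨f + f', Finset.add_mem_add hf hf', by rwa [← sub_sub]⟩

lemma Cov.add {N M : ℕ} {A B C D : Set G} (h : Cov N A B) (h' : Cov M C D) :
    Cov (N * M) (A + C) (B + D) := by
  classical
  obtain ⟨F, hF, h⟩ := h
  obtain ⟨F', hF', h'⟩ := h'
  refine ⟨F + F', Finset.card_add_le.trans (Nat.mul_le_mul hF hF'), ?_⟩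
  rintro x hx
  obtain ⟨a, ha, c, hc, rfl⟩ := Set.mem_add.1 hx
  obtain ⟨f, hf, hb⟩ := h a ha
  obtain ⟨f', hf', hd⟩ := h' c hc
  refine ⟨f + f', Finset.add_mem_add hf hf', Set.mem_add.2 ⟨_, hb, _, hd, by abel⟩⟩

/-- choosing representatives inside the covered set -/
lemma Cov.rep {N : ℕ} {A A' B C : Set G} (h : Cov N A B) (hA : A' ⊆ A)
    (hC : ∀ a ∈ A', ∀ a' ∈ A', ∀ f, a - f ∈ B → a' - f ∈ B → a - a' ∈ C) :
    ∃ F : Finset G, F.card ≤ N ∧ (↑F ⊆ A') ∧ ∀ a ∈ A', ∃ f ∈ F, a - f ∈ C := by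
  classical
  obtain ⟨F, hF, h⟩ := h
  let g : G → G := fun f => if hf : ∃ a ∈ A', a - f ∈ B then hf.choose else 0
  refine ⟨(F.filter (fun f => ∃ a ∈ A', a - f ∈ B)).image g,
    Finset.card_image_le.trans ((Finset.card_filter_le _ _).trans hF), ?_, ?_⟩
  · intro x hx
    simp only [Finset.coe_image, Finset.coe_filter, Set.mem_image, Set.mem_ofPred_eq] at hx
    obtain ⟨f, ⟨hf, hex⟩, rfl⟩ := hx
    simp only [g, dif_pos hex]
    exact hex.choose_spec.1
  · intro a ha
    obtain ⟨f, hf, hb⟩ := h a (hA ha)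
    have hex : ∃ a ∈ A', a - f ∈ B := ⟨a, ha, hb⟩
    refine ⟨g f, Finset.mem_image_of_mem _ (Finset.mem_filter.2 ⟨hf, hex⟩), ?_⟩
    simp only [g, dif_pos hex]
    exact hC a ha _ hex.choose_spec.1 f hb hex.choose_spec.2

lemma Cov.of_rep {N : ℕ} {A C : Set G}
    (h : ∃ F : Finset G, F.card ≤ N ∧ (↑F ⊆ A) ∧ ∀ a ∈ A, ∃ f ∈ F, a - f ∈ C) : Cov N A C := by
  obtain ⟨F, h1, -, h3⟩ := h
  exact ⟨F, h1, h3⟩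

lemma nsum_mono_left {S T : Set G} (h : S ⊆ T) (n : ℕ) : nsum S n ⊆ nsum T n := by
  induction n with
  | zero => exact subset_rfl
  | succ n ih => exact Set.add_subset_add ih h

lemma nsum_add (S : Set G) (a b : ℕ) : nsum S a + nsum S b = nsum S (a + b) := by
  induction b with
  | zero => simp [nsum]
  | succ b ih => rw [nsum, ← add_assoc, ih]; rfl

lemma nsum_one (S : Set G) : nsum S 1 = S := by simp [nsum]

lemma nsum_nsum (S : Set G) (a b : ℕ) : nsum (nsum S a) b = nsum S (a * b) := by
  induction b with
  | zero => simp [nsum]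
  | succ b ih => rw [nsum, ih, nsum_add]; rfl

lemma zero_mem_nsum {S : Set G} (h : (0 : G) ∈ S) (n : ℕ) : (0 : G) ∈ nsum S n := by
  induction n with
  | zero => simp [nsum]
  | succ n ih => exact Set.mem_add.2 ⟨0, ih, 0, h, by simp⟩

lemma nsum_mono {S : Set G} (h : (0 : G) ∈ S) {a b : ℕ} (hab : a ≤ b) :
    nsum S a ⊆ nsum S b := by
  obtain ⟨c, rfl⟩ := Nat.exists_eq_add_of_le hab
  rw [← nsum_add]
  intro x hx
  exact Set.mem_add.2 ⟨x, hx, 0, zero_mem_nsum h c, by simp⟩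

lemma nsmul_mem_nsum {S : Set G} {s : G} (hs : s ∈ S) (n : ℕ) : n • s ∈ nsum S n := by
  induction n with
  | zero => simp [nsum]
  | succ n ih => rw [succ_nsmul]; exact Set.add_mem_add ih hs

lemma neg_mem_nsum {S : Set G} (h : ∀ x ∈ S, -x ∈ S) (n : ℕ) :
    ∀ x ∈ nsum S n, -x ∈ nsum S n := by
  induction n with
  | zero => simp [nsum]
  | succ n ih =>
    intro x hx
    obtain ⟨a, ha, b, hb, rfl⟩ := Set.mem_add.1 hx
    rw [neg_add]
    exact Set.add_mem_add (ih a ha) (h b hb)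

lemma sub_mem_nsum {S : Set G} (h : ∀ x ∈ S, -x ∈ S) {a b : ℕ} {x y : G} (hx : x ∈ nsum S a)
    (hy : y ∈ nsum S b) : x - y ∈ nsum S (a + b) := by
  rw [← nsum_add, sub_eq_add_neg]
  exact Set.add_mem_add hx (neg_mem_nsum h b y hy)

lemma nsum_finite {S : Set G} (h : S.Finite) (n : ℕ) : (nsum S n).Finite := by
  induction n with
  | zero => simp [nsum]
  | succ n ih => exact ih.add h

lemma nsum_sub_closure (S : Set G) (n : ℕ) : nsum S n ⊆ AddSubgroup.closure S := by
  induction n with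
  | zero => simp [nsum]
  | succ n ih =>
    intro x hx
    obtain ⟨a, ha, b, hb, rfl⟩ := Set.mem_add.1 hx
    exact add_mem (ih ha) (AddSubgroup.subset_closure hb)

lemma nsum_cov {X : Set G} {K : ℕ} (h : Cov K (X + X) X) (n : ℕ) :
    Cov (K ^ n) (nsum X (n + 1)) X := by
  induction n with
  | zero => rw [nsum_one, pow_zero]; exact Cov.refl X
  | succ n ih =>
    have := (ih.add (Cov.refl X)).trans h
    rw [mul_one] at this
    rw [pow_succ]
    exact this

lemma nsum_cov' {A B : Set G} {K : ℕ} (h : Cov K A B) (n : ℕ) :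
    Cov (K ^ n) (nsum A n) (nsum B n) := by
  induction n with
  | zero => simpa [nsum] using Cov.refl ({0} : Set G)
  | succ n ih => rw [pow_succ]; exact ih.add h

lemma cov_inf {N M : ℕ} {X : Set G} {D E : AddSubgroup G} (h : Cov N X (D : Set G))
    (h' : Cov M X (E : Set G)) : Cov (N * M) X ((D ⊓ E : AddSubgroup G) : Set G) := by
  classical
  obtain ⟨F, hF, h⟩ := h
  obtain ⟨F', hF', h'⟩ := h'
  let g : G × G → G := fun p => if hp : ∃ a ∈ X, a - p.1 ∈ D ∧ a - p.2 ∈ E then hp.choose else 0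
  refine ⟨(F ×ˢ F').image g, Finset.card_image_le.trans
    (by rw [Finset.card_product]; exact Nat.mul_le_mul hF hF'), fun a ha => ?_⟩
  obtain ⟨f, hf, hb⟩ := h a ha
  obtain ⟨f', hf', hb'⟩ := h' a ha
  have hp : ∃ a ∈ X, a - (f, f').1 ∈ D ∧ a - (f, f').2 ∈ E := ⟨a, ha, hb, hb'⟩
  refine ⟨g (f, f'), Finset.mem_image_of_mem _ (Finset.mk_mem_product hf hf'), ?_⟩
  simp only [g, dif_pos hp]
  obtain ⟨-, h1, h2⟩ := hp.choose_spec
  constructor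
  · have := D.sub_mem hb h1
    simpa using this
  · have := E.sub_mem hb' h2
    simpa using this

lemma cov_comap {N : ℕ} {X : Set G} {E : AddSubgroup G} (φ : G →+ G)
    (h : Cov N (φ '' X) (E : Set G)) : Cov N X ((E.comap φ : AddSubgroup G) : Set G) := by
  classical
  obtain ⟨F, hF, hsub, h⟩ := h.rep (A' := φ '' X) (C := (E : Set G)) subset_rfl (by
    intro a _ a' _ f h1 h2
    have := E.sub_mem h1 h2
    simpa using this)
  choose! g hg hg' using fun f (hf : f ∈ F) => hsub hf
  refine ⟨F.image g, Finset.card_image_le.trans hF, fun a ha => ?_⟩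
  obtain ⟨f, hf, hb⟩ := h (φ a) ⟨a, ha, rfl⟩
  refine ⟨g f, Finset.mem_image_of_mem _ hf, ?_⟩
  simp only [AddSubgroup.coe_comap, Set.mem_preimage, map_sub, hg' f hf]
  exact hb

lemma cov_iInf {ι : Type*} {N M : ℕ} {X : Set G} {D : AddSubgroup G} (E : ι → AddSubgroup G)
    (I : Finset ι) (h : Cov N X (D : Set G)) (h' : ∀ i ∈ I, Cov M X (E i : Set G)) :
    ∃ D' : AddSubgroup G, D' ≤ D ∧ (∀ i ∈ I, D' ≤ E i) ∧
      Cov (N * M ^ I.card) X (D' : Set G) := by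
  classical
  induction I using Finset.induction_on with
  | empty => exact ⟨D, le_rfl, by simp, by simpa using h⟩
  | insert a s ha ih =>
    obtain ⟨D', h1, h2, h3⟩ := ih (fun i hi => h' i (Finset.mem_insert_of_mem hi))
    refine ⟨D' ⊓ E a, inf_le_left.trans h1, ?_, ?_⟩
    · intro i hi
      rcases Finset.mem_insert.1 hi with rfl | hi
      · exact inf_le_right
      · exact inf_le_left.trans (h2 i hi)
    · have := cov_inf h3 (h' a (Finset.mem_insert_self _ _))
      rwa [Finset.card_insert_of_notMem ha, pow_succ, ← mul_assoc]

end cov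

/-! ### The Sanders / Croot-Sisask type lemma -/

section sanders
variable {G : Type u} [AddCommGroup G] [DecidableEq G]

/-- translates by elements of `nsum S p` move `C` by little -/
lemma almost_stable (C : Finset G) (S : Set G) (m : ℕ)
    (hS : ∀ x ∈ S, (m + 1) * (C.filter (fun c => c - x ∉ C)).card ≤ C.card) (p : ℕ) :
    ∀ x ∈ nsum S p, (m + 1) * (C.filter (fun c => c - x ∉ C)).card ≤ p * C.card := by
  induction p with
  | zero =>
    intro x hx
    simp only [nsum, Set.mem_singleton_iff] at hx
    subst hx
    have : C.filter (fun c => c - 0 ∉ C) = ∅ := by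
      ext c; simp
    rw [this]; simp
  | succ p ih =>
    intro z hz
    obtain ⟨x, hx, y, hy, rfl⟩ := Set.mem_add.1 hz
    have h1 := ih x hx
    have h2 := hS y hy
    have : (C.filter (fun c => c - (x + y) ∉ C)).card ≤
        (C.filter (fun c => c - x ∉ C)).card + (C.filter (fun c => c - y ∉ C)).card := by
      have hsub : C.filter (fun c => c - (x + y) ∉ C) ⊆
          (C.filter (fun c => c - x ∉ C)) ∪ ((C.filter (fun c => c - y ∉ C)).image (· + x)) := by
        intro c hc
        simp only [Finset.mem_filter, Finset.mem_union, Finset.mem_image] at hc ⊢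
        by_cases h : c - x ∈ C
        · right
          refine ⟨c - x, ⟨h, ?_⟩, by abel⟩
          rw [sub_sub]; exact hc.2
        · left; exact ⟨hc.1, h⟩
      exact (Finset.card_le_card hsub).trans ((Finset.card_union_le _ _).trans
        (Nat.add_le_add_left Finset.card_image_le _))
    nlinarith

lemma sum_corr (A B : Finset G) (hneg : ∀ a ∈ A, -a ∈ A) (hB : B ⊆ A) :
    B.card * B.card ≤ ∑ x ∈ A + A, (B.filter (fun b => b - x ∈ B)).card := by
  rw [← Finset.card_product]
  rw [Finset.card_eq_sum_card_fiberwise (f := fun p : G × G => p.1 - p.2) (t := A + A)]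
  · refine Finset.sum_le_sum fun x _ => ?_
    refine Finset.card_le_card_of_injOn (fun p => p.1) ?_ ?_
    · intro p hp
      simp only [Finset.coe_filter, Finset.mem_product, Set.mem_ofPred_eq] at hp ⊢
      refine ⟨hp.1.1, ?_⟩
      rw [← hp.2]; simpa using hp.1.2
    · intro p hp p' hp' h
      simp only [Finset.coe_filter, Finset.mem_product, Set.mem_ofPred_eq] at hp hp'
      simp only at h
      refine Prod.ext h ?_
      have := hp.2.trans hp'.2.symm
      rw [h] at this
      exact sub_right_injective this
  · intro p hp
    simp only [Finset.coe_product, Set.mem_prod, Finset.mem_coe] at hp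
    simp only [Finset.mem_coe]
    rw [sub_eq_add_neg]
    exact Finset.add_mem_add (hB hp.1) (hneg _ (hB hp.2))

lemma sanders_step (K m : ℕ) (hK : 1 ≤ K) (t : ℝ) (ht : 0 < t) (A B : Finset G)
    (hA : A.Nonempty) (hneg : ∀ a ∈ A, -a ∈ A) (hd : (A + A).card ≤ K * A.card) (hB : B ⊆ A)
    (hBc : t * A.card ≤ B.card)
    (hstab : ∀ B' ⊆ B, t ^ 2 / (2 * K) * A.card ≤ B'.card →
      m * (A + B).card ≤ (m + 1) * (A + B').card) :
    ∃ S : Finset G, 0 ∈ S ∧ (∀ x ∈ S, -x ∈ S) ∧ S ⊆ A + A ∧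
      nsum (S : Set G) m ⊆ nsum (A : Set G) 4 ∧ t ^ 2 / 2 * A.card ≤ S.card := by
  have hA0 : (0 : ℝ) < A.card := by exact_mod_cast hA.card_pos
  have hK0 : (0 : ℝ) < K := by exact_mod_cast hK
  have hK1 : (1 : ℝ) ≤ K := by exact_mod_cast hK
  have hτ : 0 < t ^ 2 / (2 * K) * (A.card : ℝ) := by positivity
  set τ := t ^ 2 / (2 * K) * (A.card : ℝ) with hτdef
  have hBpos : (0 : ℝ) < B.card := lt_of_lt_of_le (by positivity) hBc
  have hBne : B.Nonempty := by
    rw [← Finset.card_pos]; exact_mod_cast hBpos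
  have ht1 : t ≤ 1 := by
    have : (B.card : ℝ) ≤ A.card := by exact_mod_cast Finset.card_le_card hB
    by_contra h
    push Not at h
    nlinarith
  set r : G → Finset G := fun x => B.filter (fun b => b - x ∈ B) with hr
  refine ⟨(A + A).filter (fun x => τ ≤ (r x).card), ?_, ?_, Finset.filter_subset _ _, ?_, ?_⟩
  · rw [Finset.mem_filter]
    constructor
    · obtain ⟨a, ha⟩ := hA
      have := Finset.add_mem_add ha (hneg a ha)
      simpa using this
    · have : r 0 = B := by ext b; simp [hr]
      rw [this]
      refine le_trans ?_ hBc
      rw [hτdef]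
      refine mul_le_mul_of_nonneg_right ?_ hA0.le
      rw [div_le_iff₀ (by positivity)]
      nlinarith
  · intro x hx
    rw [Finset.mem_filter] at hx ⊢
    constructor
    · obtain ⟨a, ha, b, hb, h⟩ := Finset.mem_add.1 hx.1
      rw [← h, neg_add]
      exact Finset.add_mem_add (hneg a ha) (hneg b hb)
    · refine hx.2.trans ?_
      have : (r x).card ≤ (r (-x)).card := by
        refine Finset.card_le_card_of_injOn (fun b => b - x) ?_ ?_
        · intro b hb
          simp only [hr, Finset.coe_filter, Set.mem_ofPred_eq] at hb ⊢
          exact ⟨hb.2, by simpa using hb.1⟩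
        · intro b _ b' _ h
          exact sub_left_injective h
      exact_mod_cast this
  · intro z hz
    have hmain := almost_stable (A + B)
      (((A + A).filter (fun x => τ ≤ (r x).card) : Finset G) : Set G) m ?_ m z hz
    · have hCpos : 0 < (A + B).card := (hA.add hBne).card_pos
      have hlt : ((A + B).filter (fun c => c - z ∉ A + B)).card < (A + B).card := by
        by_contra h
        push Not at h
        nlinarith
      have : ∃ c ∈ A + B, c - z ∈ A + B := by
        by_contra h
        push Not at h
        rw [Finset.filter_true_of_mem h] at hlt
        exact lt_irrefl _ hlt
      obtain ⟨c, hc, hcz⟩ := this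
      have hc2 : ∀ c ∈ A + B, c ∈ nsum (A : Set G) 2 := by
        intro c hc
        obtain ⟨a, ha, b, hb, h⟩ := Finset.mem_add.1 hc
        rw [← h]
        have h2 : nsum (A : Set G) 2 = (A : Set G) + A := by
          rw [show (2 : ℕ) = 1 + 1 from rfl, ← nsum_add, nsum_one]
        rw [h2]
        exact Set.add_mem_add ha (hB hb)
      have := sub_mem_nsum (S := (A : Set G)) hneg (hc2 c hc) (hc2 _ hcz)
      simpa using this
    · intro x hx
      simp only [Finset.coe_filter, Set.mem_ofPred_eq] at hx
      have h1 := hstab (r x) (Finset.filter_subset _ _) hx.2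
      have h2 : A + r x ⊆ (A + B).filter (fun c => c - x ∈ A + B) := by
        intro c hc
        obtain ⟨a, ha, b, hb, h⟩ := Finset.mem_add.1 hc
        simp only [hr, Finset.mem_filter] at hb
        rw [Finset.mem_filter, ← h]
        refine ⟨Finset.add_mem_add ha hb.1, ?_⟩
        rw [add_sub_assoc]
        exact Finset.add_mem_add ha hb.2
      have h3 := Finset.card_le_card h2
      have h4 := Finset.card_filter_add_card_filter_not (s := A + B) (fun c => c - x ∈ A + B)
      nlinarith
  · set S := (A + A).filter (fun x => τ ≤ (r x).card) with hS
    have h1 := sum_corr A B hneg hB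
    have h1' : (B.card : ℝ) * B.card ≤ ∑ x ∈ A + A, ((r x).card : ℝ) := by exact_mod_cast h1
    rw [← Finset.sum_filter_add_sum_filter_not (A + A) (fun x => τ ≤ (r x).card)] at h1'
    have h2 : ∑ x ∈ (A + A).filter (fun x => τ ≤ ((r x).card : ℝ)), ((r x).card : ℝ)
        ≤ S.card * B.card := by
      rw [← nsmul_eq_mul]
      refine Finset.sum_le_card_nsmul _ _ _ fun x _ => ?_
      exact_mod_cast Finset.card_le_card (Finset.filter_subset _ _)
    have h3 : ∑ x ∈ (A + A).filter (fun x => ¬ τ ≤ ((r x).card : ℝ)), ((r x).card : ℝ)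
        ≤ (K * A.card) * τ := by
      calc _ ≤ ((A + A).filter (fun x => ¬ τ ≤ ((r x).card : ℝ))).card • τ := by
            refine Finset.sum_le_card_nsmul _ _ _ fun x hx => ?_
            rw [Finset.mem_filter] at hx
            exact (not_le.1 hx.2).le
        _ ≤ _ := by
            rw [nsmul_eq_mul]
            refine mul_le_mul_of_nonneg_right ?_ hτ.le
            exact_mod_cast (Finset.card_filter_le _ _).trans hd
    have h4 : (K * A.card) * τ = (t * A.card) ^ 2 / 2 := by
      rw [hτdef]; field_simp
    have h5 : (t * A.card) * (t * A.card) ≤ (B.card : ℝ) * B.card :=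
      mul_le_mul hBc hBc (by positivity) (by positivity)
    have h6 : (B.card : ℝ) ≤ A.card := by exact_mod_cast Finset.card_le_card hB
    have h7 : (S.card : ℝ) * B.card ≤ S.card * A.card :=
      mul_le_mul_of_nonneg_left h6 (by positivity)
    have h8 : (t ^ 2 / 2 * A.card) * A.card ≤ S.card * A.card := by nlinarith
    exact le_of_mul_le_mul_right h8 hA0

end sanders

lemma sanders_aux (K m : ℕ) (hK : 1 ≤ K) (n : ℕ) : ∀ t : ℝ, 0 < t → ∃ c : ℝ, 0 < c ∧
    ∀ (G : Type u) [AddCommGroup G] [DecidableEq G] (A B : Finset G), A.Nonempty →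
      (∀ a ∈ A, -a ∈ A) → (A + A).card ≤ K * A.card → B ⊆ A → t * A.card ≤ B.card →
      (A + B).card * m ^ n < (m + 1) ^ n * A.card →
      ∃ S : Finset G, 0 ∈ S ∧ (∀ x ∈ S, -x ∈ S) ∧ S ⊆ A + A ∧
        nsum (S : Set G) m ⊆ nsum (A : Set G) 4 ∧ c * A.card ≤ S.card := by
  induction n with
  | zero =>
    intro t ht
    refine ⟨1, one_pos, ?_⟩
    intro G _ _ A B hA hneg hd hB hBc hlt
    exfalso
    simp only [pow_zero, mul_one, one_mul] at hlt
    have hA0 : (0 : ℝ) < A.card := by exact_mod_cast hA.card_pos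
    have hBpos : (0 : ℝ) < B.card := lt_of_lt_of_le (by positivity) hBc
    have hBne : B.Nonempty := by
      rw [← Finset.card_pos]; exact_mod_cast hBpos
    exact absurd (Finset.card_le_card_add_right hBne) (not_le.2 hlt)
  | succ n ih =>
    intro t ht
    have hK0 : (0 : ℝ) < K := by exact_mod_cast hK
    obtain ⟨c, hc, h⟩ := ih (t ^ 2 / (2 * K)) (by positivity)
    refine ⟨min c (t ^ 2 / 2), lt_min hc (by positivity), ?_⟩
    intro G _ _ A B hA hneg hd hB hBc hlt
    have hA0 : (0 : ℝ) < A.card := by exact_mod_cast hA.card_pos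
    by_cases hstab : ∀ B' ⊆ B, t ^ 2 / (2 * K) * A.card ≤ B'.card →
      m * (A + B).card ≤ (m + 1) * (A + B').card
    · obtain ⟨S, h1, h2, h3, h4, h5⟩ := sanders_step K m hK t ht A B hA hneg hd hB hBc hstab
      exact ⟨S, h1, h2, h3, h4,
        (mul_le_mul_of_nonneg_right (min_le_right _ _) hA0.le).trans h5⟩
    · push Not at hstab
      obtain ⟨B', hB', hc', hlt'⟩ := hstab
      obtain ⟨S, h1, h2, h3, h4, h5⟩ := h G A B' hA hneg hd (hB'.trans hB) hc' (by
        have e1 : (m + 1) * ((A + B').card * m ^ n) < (m + 1) * ((m + 1) ^ n * A.card) := by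
          calc (m + 1) * ((A + B').card * m ^ n) = ((m + 1) * (A + B').card) * m ^ n := by ring
            _ ≤ (m * (A + B).card) * m ^ n := Nat.mul_le_mul_right _ hlt'.le
            _ = (A + B).card * m ^ (n + 1) := by ring
            _ < (m + 1) ^ (n + 1) * A.card := hlt
            _ = _ := by ring
        exact lt_of_mul_lt_mul_left e1 (Nat.zero_le _))
      exact ⟨S, h1, h2, h3, h4,
        (mul_le_mul_of_nonneg_right (min_le_left _ _) hA0.le).trans h5⟩

/-- For every `m`, a finite approximate group `X` contains (up to 4-fold sums) the `m`-fold sumset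
of a symmetric set `S` such that boundedly many translates of `S + S` cover `X`. -/
lemma sanders (K m : ℕ) (hK : 1 ≤ K) (hm : 1 ≤ m) : ∃ N : ℕ,
    ∀ (G : Type u) [AddCommGroup G] (X : Set G), X.Finite → (0 : G) ∈ X → (∀ x ∈ X, -x ∈ X) →
      Cov K (X + X) X →
      ∃ S : Set G, (0 : G) ∈ S ∧ (∀ x ∈ S, -x ∈ S) ∧ S ⊆ nsum X 2 ∧ nsum S m ⊆ nsum X 4 ∧
        Cov N X (nsum S 2) := by
  have hm0 : (0 : ℝ) < m := by exact_mod_cast hm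
  obtain ⟨n, hn⟩ := pow_unbounded_of_one_lt (K : ℝ) (y := ((m : ℝ) + 1) / m)
    (by rw [lt_div_iff₀ hm0]; linarith)
  obtain ⟨c, hc, h⟩ := sanders_aux.{u} K m hK n 1 one_pos
  refine ⟨⌊(K : ℝ) ^ 2 / c⌋₊, ?_⟩
  intro G _ X hX h0 hneg hcov
  classical
  lift X to Finset G using hX
  have hXne : X.Nonempty := ⟨0, h0⟩
  have hX0 : (0 : ℝ) < X.card := by exact_mod_cast hXne.card_pos
  have hcard : ∀ k, ∀ Z : Finset G, (Z : Set G) ⊆ nsum (X : Set G) (k + 1) →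
      Z.card ≤ K ^ k * X.card := by
    intro k Z hZ
    obtain ⟨F, hF, hFX⟩ := nsum_cov hcov k
    have : Z ⊆ F + X := by
      intro z hz
      obtain ⟨f, hf, hb⟩ := hFX z (hZ hz)
      exact Finset.mem_add.2 ⟨f, hf, z - f, hb, by abel⟩
    exact (Finset.card_le_card this).trans (Finset.card_add_le.trans (Nat.mul_le_mul_right _ hF))
  have h2 : nsum (X : Set G) 2 = (X : Set G) + X := by
    rw [show (2 : ℕ) = 1 + 1 from rfl, ← nsum_add, nsum_one]
  have hd : (X + X).card ≤ K * X.card := by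
    have := hcard 1 (X + X) (by rw [Finset.coe_add]; exact h2.symm.subset)
    simpa using this
  obtain ⟨S, hS0, hSneg, hS2, hSm, hSc⟩ := h G X X hXne hneg hd subset_rfl (by simp) (by
    have e1 : (K : ℝ) * m ^ n < (m + 1) ^ n := by
      rw [div_pow, lt_div_iff₀ (by positivity)] at hn
      exact hn
    have e2 : K * m ^ n < (m + 1) ^ n := by exact_mod_cast e1
    calc (X + X).card * m ^ n ≤ K * X.card * m ^ n := Nat.mul_le_mul_right _ hd
      _ = (K * m ^ n) * X.card := by ring
      _ < _ := Nat.mul_lt_mul_of_pos_right e2 hXne.card_pos)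
  have hS2' : (S : Set G) ⊆ nsum (X : Set G) 2 := by
    intro s hs
    rw [h2, ← Finset.coe_add]
    exact hS2 hs
  have hS2n : nsum (S : Set G) 2 = (S : Set G) + S := by
    rw [show (2 : ℕ) = 1 + 1 from rfl, ← nsum_add, nsum_one]
  refine ⟨S, hS0, hSneg, hS2', hSm, ?_⟩
  have hXS : (X + S).card ≤ K ^ 2 * X.card := by
    refine hcard 2 _ ?_
    rw [Finset.coe_add, show (2 + 1 : ℕ) = 1 + 2 from rfl, ← nsum_add, nsum_one]
    exact Set.add_subset_add subset_rfl hS2'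
  obtain ⟨F, hFX, hFc, hF⟩ := Finset.ruzsa_covering_add (K := (K : ℝ) ^ 2 / c) (A := X) (B := S)
    ⟨0, hS0⟩ (by
      have : ((X + S).card : ℝ) ≤ K ^ 2 * X.card := by exact_mod_cast hXS
      refine this.trans ?_
      rw [div_mul_eq_mul_div, le_div_iff₀ hc]
      nlinarith [sq_nonneg (K : ℝ)])
  refine ⟨F, Nat.le_floor hFc, ?_⟩
  intro a ha
  obtain ⟨f, hf, d, hd', hfd⟩ := Finset.mem_add.1 (hF ha)
  refine ⟨f, hf, ?_⟩
  obtain ⟨s, hs, s', hs', hd''⟩ := Finset.mem_sub.1 hd'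
  rw [hS2n]
  have : a - f = s + -s' := by rw [← hfd, ← hd'']; abel
  rw [this]
  exact Set.add_mem_add hs (hSneg _ hs')

/-! ### Passing from a subgroup to a subring -/

section ringstep
variable {R : Type u} [NonUnitalRing R]

lemma nsum_mul_nsum (X : Set R) (a b : ℕ) : nsum X a * nsum X b ⊆ nsum (X * X) (a * b) := by
  have h1 : ∀ b, ∀ x ∈ X, ∀ z ∈ nsum X b, x * z ∈ nsum (X * X) b := by
    intro b
    induction b with
    | zero =>
      intro x _ z hz
      simp only [nsum, Set.mem_singleton_iff] at hz ⊢
      simp [hz]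
    | succ b ih =>
      intro x hx z hz
      obtain ⟨p, hp, q, hq, rfl⟩ := Set.mem_add.1 hz
      rw [mul_add]
      exact Set.add_mem_add (ih x hx p hp) (Set.mul_mem_mul hx hq)
  induction a with
  | zero =>
    intro z hz
    obtain ⟨p, hp, q, hq, rfl⟩ := Set.mem_mul.1 hz
    simp only [nsum, Set.mem_singleton_iff] at hp
    simp [hp, nsum]
  | succ a ih =>
    intro z hz
    obtain ⟨p, hp, q, hq, rfl⟩ := Set.mem_mul.1 hz
    obtain ⟨p2, hp2, x, hx, rfl⟩ := Set.mem_add.1 hp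
    rw [Nat.succ_mul a b, ← nsum_add, add_mul p2 x q]
    exact Set.add_mem_add (ih (Set.mul_mem_mul hp2 hq)) (h1 b x hx q hq)

lemma mul_cov {X : Set R} {K : ℕ} (hadd : Cov K (X + X) X) (hmul : Cov K (X * X) X)
    (a b k : ℕ) (h : a * b = k + 1) : Cov (K ^ (2 * k + 1)) (nsum X a * nsum X b) X := by
  have h1 := (nsum_cov' hmul (k + 1)).trans (nsum_cov hadd k)
  refine h1.mono (le_of_eq (by rw [← pow_add]; congr 1; ring)) ?_ subset_rfl
  rw [← h]; exact nsum_mul_nsum X a b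

lemma cov_map {N : ℕ} {A B : Set R} (φ : R →+ R) (h : Cov N A B) : Cov N (φ '' A) (φ '' B) := by
  classical
  obtain ⟨F, hF, h⟩ := h
  refine ⟨F.image φ, Finset.card_image_le.trans hF, ?_⟩
  rintro _ ⟨a, ha, rfl⟩
  obtain ⟨f, hf, hb⟩ := h a ha
  exact ⟨φ f, Finset.mem_image_of_mem _ hf, ⟨_, hb, by simp⟩⟩

lemma cov_pos {G : Type u} [AddCommGroup G] {N : ℕ} {A B : Set G} (h : Cov N A B) {a : G}
    (ha : a ∈ A) : 0 < N := by
  obtain ⟨F, hF, h⟩ := h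
  obtain ⟨f, hf, -⟩ := h a ha
  exact (Finset.card_pos.2 ⟨f, hf⟩).trans_le hF

/-- the left order of an additive subgroup, intersected with that subgroup -/
def leftOrder (H : AddSubgroup R) : NonUnitalSubring R where
  carrier := {t | t ∈ H ∧ ∀ g ∈ H, t * g ∈ H}
  add_mem' := by
    rintro a b ⟨ha, ha'⟩ ⟨hb, hb'⟩
    refine ⟨add_mem ha hb, fun g hg => ?_⟩
    rw [add_mul]; exact add_mem (ha' g hg) (hb' g hg)
  zero_mem' := ⟨zero_mem _, fun g _ => by rw [zero_mul]; exact zero_mem _⟩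
  mul_mem' := by
    rintro a b ⟨ha, ha'⟩ ⟨hb, hb'⟩
    refine ⟨ha' b hb, fun g hg => ?_⟩
    rw [mul_assoc]; exact ha' _ (hb' g hg)
  neg_mem' := by
    rintro a ⟨ha, ha'⟩
    refine ⟨neg_mem ha, fun g hg => ?_⟩
    rw [neg_mul]; exact neg_mem (ha' g hg)

lemma mem_leftOrder {H : AddSubgroup R} {t : R} :
    t ∈ leftOrder H ↔ t ∈ H ∧ ∀ g ∈ H, t * g ∈ H := Iff.rfl

/-- pigeonhole: an element all of whose multiples lie in finitely many cosets is torsion modulo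
the subgroup -/
lemma exists_nsmul_mem {G : AddSubgroup R} (F : Finset R) (z : R)
    (h : ∀ k : ℕ, ∃ f ∈ F, k • z - f ∈ G) : ∃ n : ℕ, n ≠ 0 ∧ n • z ∈ G := by
  choose g hg hg' using h
  obtain ⟨a, b, hab, he⟩ := Finite.exists_ne_map_eq_of_infinite
    (fun k : ℕ => (⟨g k, hg k⟩ : F))
  simp only [Subtype.mk.injEq] at he
  wlog hlt : a < b generalizing a b
  · exact this b a hab.symm he.symm (lt_of_le_of_ne (not_lt.1 hlt) hab.symm)
  refine ⟨b - a, by omega, ?_⟩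
  have h1 := G.sub_mem (hg' b) (hg' a)
  rw [he, sub_sub_sub_cancel_right] at h1
  rwa [sub_nsmul _ hlt.le, ← sub_eq_add_neg]

lemma ring_step (K N : ℕ) (X : Set R) (hfin : X.Finite) (h0 : (0 : R) ∈ X)
    (hneg : ∀ x ∈ X, -x ∈ X) (hadd : Cov K (X + X) X) (hmul : Cov K (X * X) X)
    (G : AddSubgroup R) (hG : AddSubgroup.closure (nsum X 2 ∩ G) = G)
    (hN : Cov N X (G : Set R)) :
    ∃ T : NonUnitalSubring R,
      Cov ((N * (K ^ 7 * N) ^ (K ^ 3)) * (K ^ 6 * N) ^ (K ^ 7 * N)) X (T : Set R) ∧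
      (∃ Z : Set R, Z.Finite ∧ (T : Set R) ⊆ AddSubgroup.closure Z) ∧
      ∀ t ∈ T, ∃ n : ℕ, n ≠ 0 ∧ n • t ∈ G := by
  have hN0 : 0 < N := cov_pos hN h0
  have hK0 : 0 < K := cov_pos hadd (Set.add_mem_add h0 h0)
  set X1 : Set R := nsum X 2 ∩ G with hX1
  -- `F1`
  obtain ⟨F1, hF1c, hF1sub, hF1⟩ := (nsum_cov hadd 3).rep (A' := nsum X 4 ∩ G) (C := X1)
    Set.inter_subset_left (by
      intro a ha a' ha' f h1 h2
      refine ⟨?_, G.sub_mem ha.2 ha'.2⟩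
      rw [← nsum_one X] at h1 h2
      have := sub_mem_nsum hneg h1 h2
      simpa using this)
  have hdec : ∀ g ∈ G, ∃ φ ∈ AddSubgroup.closure (F1 : Set R), g - φ ∈ X1 := by
    intro g hg
    rw [← hG] at hg
    induction hg using AddSubgroup.closure_induction with
    | mem x hx => exact ⟨0, zero_mem _, by simpa using hx⟩
    | zero => exact ⟨0, zero_mem _, by simpa using ⟨zero_mem_nsum h0 2, zero_mem G⟩⟩
    | add x y _ _ hx hy =>
      obtain ⟨φ, hφ, h1⟩ := hx
      obtain ⟨ψ, hψ, h2⟩ := hy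
      obtain ⟨f, hf, h3⟩ := hF1 ((x - φ) + (y - ψ))
        ⟨by rw [show (4 : ℕ) = 2 + 2 from rfl, ← nsum_add]; exact Set.add_mem_add h1.1 h2.1,
          G.add_mem h1.2 h2.2⟩
      refine ⟨φ + ψ + f, add_mem (add_mem hφ hψ) (AddSubgroup.subset_closure hf), ?_⟩
      have : x + y - (φ + ψ + f) = x - φ + (y - ψ) - f := by abel
      rwa [this]
    | neg x _ hx =>
      obtain ⟨φ, hφ, h1⟩ := hx
      refine ⟨-φ, neg_mem hφ, ?_⟩
      have : -x - -φ = -(x - φ) := by abel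
      rw [this]
      exact ⟨neg_mem_nsum hneg 2 _ h1.1, G.neg_mem h1.2⟩
  have h22 : Cov (K ^ 7 * N) (nsum X 2 * nsum X 2) (G : Set R) :=
    (mul_cov hadd hmul 2 2 3 rfl).trans hN
  -- the subgroup D
  obtain ⟨D, hDG, hDF, hDc⟩ := cov_iInf (M := K ^ 7 * N)
    (fun f : R => G.comap (AddMonoidHom.mulRight f)) F1 hN (by
      intro f hf
      refine cov_comap _ (((mul_cov hadd hmul 1 4 3 rfl).trans hN).mono le_rfl ?_ subset_rfl)
      rintro _ ⟨x, hx, rfl⟩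
      rw [nsum_one]
      exact Set.mul_mem_mul hx (hF1sub hf).1)
  have hDc' : Cov (N * (K ^ 7 * N) ^ (K ^ 3)) X (D : Set R) :=
    hDc.mono (Nat.mul_le_mul_left _ (Nat.pow_le_pow_right (by positivity) hF1c)) subset_rfl
      subset_rfl
  set P : Set R := nsum X 2 ∩ D with hP
  have hPc : Cov (N * (K ^ 7 * N) ^ (K ^ 3)) X ((AddSubgroup.closure P : AddSubgroup R) : Set R) := by
    refine Cov.of_rep (hDc'.rep subset_rfl ?_)
    intro a ha a' ha' f h1 h2
    refine AddSubgroup.subset_closure ⟨?_, ?_⟩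
    · rw [← nsum_one X] at ha ha'
      have := sub_mem_nsum hneg ha ha'
      simpa using this
    · have := D.sub_mem h1 h2
      simpa using this
  have hPX1 : P ⊆ X1 := fun x hx => ⟨hx.1, hDG hx.2⟩
  -- `Gp`
  set Gp : AddSubgroup R := AddSubgroup.closure (X1 ∪ P * X1) with hGp
  have hGGp : G ≤ Gp := by
    rw [← hG]; exact AddSubgroup.closure_mono Set.subset_union_left
  have hPF : ∀ x ∈ P, ∀ φ ∈ AddSubgroup.closure (F1 : Set R), x * φ ∈ G := by
    intro x hx φ hφ
    induction hφ using AddSubgroup.closure_induction with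
    | mem f hf => exact hDF f hf hx.2
    | zero => rw [mul_zero]; exact zero_mem _
    | add a b _ _ ha hb => rw [mul_add]; exact add_mem ha hb
    | neg a _ ha => rw [mul_neg]; exact neg_mem ha
  obtain ⟨F2, hF2c, hF2⟩ := h22
  have hPG : ∀ x ∈ P, ∀ g ∈ G, ∃ f ∈ F2, x * g - f ∈ G := by
    intro x hx g hg
    obtain ⟨φ, hφ, h1⟩ := hdec g hg
    obtain ⟨f, hf, h2⟩ := hF2 _ (Set.mul_mem_mul hx.1 h1.1)
    refine ⟨f, hf, ?_⟩
    have := G.add_mem (hPF x hx φ hφ) h2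
    have e : x * φ + (x * (g - φ) - f) = x * g - f := by rw [mul_sub]; abel
    rwa [e] at this
  have htors : ∀ g ∈ Gp, ∃ n : ℕ, n ≠ 0 ∧ n • g ∈ G := by
    intro g hg
    induction hg using AddSubgroup.closure_induction with
    | mem x hx =>
      rcases hx with hx | hx
      · exact ⟨1, one_ne_zero, by simpa using hx.2⟩
      · obtain ⟨p, hp, y, hy, rfl⟩ := Set.mem_mul.1 hx
        refine exists_nsmul_mem F2 _ fun k => ?_
        obtain ⟨f, hf, h⟩ := hPG p hp (k • y) (G.nsmul_mem hy.2 k)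
        exact ⟨f, hf, by rwa [mul_smul_comm] at h⟩
    | zero => exact ⟨1, one_ne_zero, by simp⟩
    | add a b _ _ ha hb =>
      obtain ⟨n, hn, h1⟩ := ha
      obtain ⟨m, hm, h2⟩ := hb
      refine ⟨n * m, mul_ne_zero hn hm, ?_⟩
      rw [smul_add]
      refine add_mem ?_ ?_
      · rw [mul_comm, mul_smul]; exact G.nsmul_mem h1 m
      · rw [mul_smul]; exact G.nsmul_mem h2 n
    | neg a _ ha =>
      obtain ⟨n, hn, h1⟩ := ha
      exact ⟨n, hn, by rw [smul_neg]; exact neg_mem h1⟩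
  have hPcG : ∀ x ∈ AddSubgroup.closure P, ∀ g ∈ G, x * g ∈ Gp := by
    intro x hx g hg
    rw [← hG] at hg
    induction hx using AddSubgroup.closure_induction with
    | mem p hp =>
      induction hg using AddSubgroup.closure_induction with
      | mem y hy => exact AddSubgroup.subset_closure (Or.inr (Set.mul_mem_mul hp hy))
      | zero => rw [mul_zero]; exact zero_mem _
      | add a b _ _ ha hb => rw [mul_add]; exact add_mem ha hb
      | neg a _ ha => rw [mul_neg]; exact neg_mem ha
    | zero => rw [zero_mul]; exact zero_mem _
    | add a b _ _ ha hb => rw [add_mul]; exact add_mem ha hb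
    | neg a _ ha => rw [neg_mul]; exact neg_mem ha
  -- `Θ`
  obtain ⟨Θ, hΘc, hΘsub, hΘ⟩ := (show Cov (K ^ 7 * N) (nsum X 2 * nsum X 2) (G : Set R) from
    ⟨F2, hF2c, hF2⟩).rep (A' := P * X1) (C := (G : Set R))
    (Set.mul_subset_mul Set.inter_subset_left Set.inter_subset_left) (by
      intro a _ a' _ f h1 h2
      have := G.sub_mem h1 h2
      simpa using this)
  obtain ⟨W, hWP, hWΘ, hWc⟩ := cov_iInf (M := K ^ 6 * N)
    (fun f : R => G.comap (AddMonoidHom.mulRight f)) Θ hPc (by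
      intro θ hθ
      obtain ⟨x, hx, y, hy, rfl⟩ := Set.mem_mul.1 (hΘsub hθ)
      have h12 := mul_cov hadd hmul 1 2 1 rfl
      have e1 := (cov_map (AddMonoidHom.mulRight y) h12).trans
        ((h12.trans hN).mono le_rfl (A' := AddMonoidHom.mulRight y '' X) (by
          rintro _ ⟨z, hz, rfl⟩
          rw [nsum_one]
          exact Set.mul_mem_mul hz hy.1) subset_rfl)
      refine cov_comap _ (e1.mono (le_of_eq (by ring)) ?_ subset_rfl)
      rintro _ ⟨z, hz, rfl⟩
      refine ⟨z * x, ?_, ?_⟩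
      · rw [nsum_one]; exact Set.mul_mem_mul hz hx.1
      · simp [mul_assoc])
  refine ⟨leftOrder Gp, ?_, ?_, ?_⟩
  · refine hWc.mono (Nat.mul_le_mul_left _ (Nat.pow_le_pow_right (by positivity) hΘc)) subset_rfl ?_
    intro w hw
    have hPG' : AddSubgroup.closure P ≤ G := by
      rw [← hG]; exact AddSubgroup.closure_mono hPX1
    refine ⟨hGGp (hPG' (hWP hw)), ?_⟩
    intro g hg
    induction hg using AddSubgroup.closure_induction with
    | mem z hz =>
      rcases hz with hz | hz
      · exact hPcG w (hWP hw) z hz.2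
      · obtain ⟨θ, hθ, h1⟩ := hΘ z hz
        have h2 := hPcG w (hWP hw) _ h1
        have h3 : w * θ ∈ G := hWΘ θ hθ hw
        have := add_mem h2 (hGGp h3)
        rwa [mul_sub, sub_add_cancel] at this
    | zero => rw [mul_zero]; exact zero_mem _
    | add a b _ _ ha hb => rw [mul_add]; exact add_mem ha hb
    | neg a _ ha => rw [mul_neg]; exact neg_mem ha
  · have hX1f : X1.Finite := (nsum_finite hfin 2).subset Set.inter_subset_left
    refine ⟨X1 ∪ P * X1, hX1f.union ((hX1f.subset hPX1).mul hX1f), ?_⟩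
    intro t ht
    exact ht.1
  · intro t ht
    exact htors t ht.1

end ringstep

/-! ### The rank bound -/

lemma nsum_image {G : Type*} {H : Type*} [AddCommGroup G] [AddCommGroup H] (f : G →+ H)
    (S : Set G) (n : ℕ) : f '' nsum S n = nsum (f '' S) n := by
  induction n with
  | zero => simp [nsum]
  | succ n ih => rw [nsum, nsum, ← ih, Set.image_add]

lemma nsum_growth {Q : Type*} [AddCommGroup Q] [Finite Q] (S : Set Q) (h0 : (0 : Q) ∈ S)
    (hneg : ∀ x ∈ S, -x ∈ S) (hS : AddSubgroup.closure S = ⊤) :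
    nsum S (Nat.card Q) = Set.univ := by
  have key : ∀ i, nsum S i = Set.univ ∨ i + 1 ≤ (nsum S i).ncard := by
    intro i
    induction i with
    | zero => right; simp [nsum]
    | succ i ih =>
      rcases ih with ih | ih
      · left
        exact Set.univ_subset_iff.1 (ih ▸ nsum_mono h0 (Nat.le_succ i))
      · by_cases he : nsum S (i + 1) = nsum S i
        · left
          rw [he]
          refine Set.univ_subset_iff.1 fun x hx0 => ?_
          clear hx0
          have hx : x ∈ AddSubgroup.closure S := by rw [hS]; trivial
          have : ∀ y ∈ nsum S i, y + x ∈ nsum S i ∧ y - x ∈ nsum S i := by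
            induction hx using AddSubgroup.closure_induction with
            | mem s hs =>
              intro y hy
              rw [← he]
              refine ⟨Set.add_mem_add hy hs, ?_⟩
              rw [sub_eq_add_neg]; exact Set.add_mem_add hy (hneg s hs)
            | zero => intro y hy; simpa using hy
            | add a b _ _ ha hb =>
              intro y hy
              rw [← add_assoc, ← sub_sub]
              exact ⟨(hb _ (ha y hy).1).1, (hb _ (ha y hy).2).2⟩
            | neg a _ ha =>
              intro y hy
              rw [← sub_eq_add_neg, sub_neg_eq_add]
              exact (ha y hy).symm
          have h1 := (this 0 (zero_mem_nsum h0 i)).1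
          simpa using h1
        · right
          have hss : nsum S i ⊂ nsum S (i + 1) :=
            (nsum_mono h0 (Nat.le_succ i)).ssubset_of_ne (Ne.symm he)
          have := Set.ncard_lt_ncard hss (Set.toFinite _)
          omega
  rcases key (Nat.card Q) with h | h
  · exact h
  · have := Set.ncard_le_card (nsum S (Nat.card Q))
    omega

lemma exists_surj (M : Type*) [AddCommGroup M] [Module.Finite ℤ M] (r : ℕ)
    (h : r ≤ Module.finrank ℤ M) : ∃ ρ : M →ₗ[ℤ] (Fin r → ℤ), Function.Surjective ρ := by
  have e : Module.finrank ℤ (M ⧸ Submodule.torsion ℤ M) = Module.finrank ℤ M := by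
    unfold Module.finrank
    rw [rank_quotient_eq_of_le_torsion le_rfl]
  let b := Module.finBasisOfFinrankEq ℤ (M ⧸ Submodule.torsion ℤ M) e
  refine ⟨(LinearMap.funLeft ℤ ℤ (Fin.castLE h)) ∘ₗ b.equivFun.toLinearMap ∘ₗ
    (Submodule.torsion ℤ M).mkQ, ?_⟩
  rw [LinearMap.coe_comp, LinearMap.coe_comp]
  refine (LinearMap.funLeft_surjective_of_injective ℤ ℤ _ (Fin.castLE_injective h)).comp
    (b.equivFun.surjective.comp (Submodule.mkQ_surjective _))

section rank
variable {R : Type u} [NonUnitalRing R]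

lemma rank_bound (K r : ℕ) (X : Set R) (hfin : X.Finite) (h0 : (0 : R) ∈ X)
    (hneg : ∀ x ∈ X, -x ∈ X) (hadd : Cov K (X + X) X) (S : Set R) (hSf : S.Finite)
    (hS0 : (0 : R) ∈ S) (hSneg : ∀ x ∈ S, -x ∈ S) (hSX : nsum S (32 ^ r) ⊆ nsum X 4)
    (v : Fin r → R) (hv : LinearIndependent ℤ v) (hvS : ∀ i, v i ∈ AddSubgroup.closure S) :
    2 ^ r ≤ K ^ 4 := by
  classical
  set G : AddSubgroup R := AddSubgroup.closure S with hG
  have : Finite S := hSf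
  have hfg : Module.Finite ℤ G := Module.Finite.iff_addGroup_fg.2 (AddGroup.closure_finite_fg S)
  have hr : r ≤ Module.finrank ℤ G := by
    have : LinearIndependent ℤ (fun i => (⟨v i, hvS i⟩ : G)) :=
      LinearIndependent.of_comp G.subtype.toIntLinearMap hv
    simpa using this.fintype_card_le_finrank
  obtain ⟨ρ, hρ⟩ := exists_surj G r hr
  -- reduction modulo 32
  let red : (Fin r → ℤ) →+ (Fin r → ZMod 32) := (Int.castAddHom (ZMod 32)).compLeft (Fin r)
  have hred : Function.Surjective red := by
    intro c
    refine ⟨fun i => (c i).cast, ?_⟩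
    funext i
    simp [red]
  let φ : G →+ (Fin r → ZMod 32) := red.comp ρ.toAddMonoidHom
  have hφ : Function.Surjective φ := hred.comp hρ
  have hcard : Nat.card (Fin r → ZMod 32) = 32 ^ r := by simp
  have htop : AddSubgroup.closure ((Subtype.val : G → R) ⁻¹' S) = ⊤ :=
    AddSubgroup.closure_closure_coe_preimage
  have hgrow := nsum_growth (φ '' (Subtype.val ⁻¹' S)) ⟨0, hS0, by simp⟩ (by
    rintro _ ⟨x, hx, rfl⟩
    exact ⟨-x, hSneg _ hx, by simp⟩) (by
    rw [← AddMonoidHom.map_closure, htop,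
      ← AddMonoidHom.range_eq_map, AddMonoidHom.range_eq_top]
    exact hφ)
  rw [hcard, ← nsum_image] at hgrow
  have hD : ∀ c : Fin r → ZMod 32, ∃ d : G, (d : R) ∈ nsum X 4 ∧ φ d = c := by
    intro c
    have : c ∈ (Set.univ : Set (Fin r → ZMod 32)) := trivial
    rw [← hgrow] at this
    obtain ⟨d, hd, rfl⟩ := this
    refine ⟨d, hSX ?_, rfl⟩
    have h1 : G.subtype d ∈ nsum (G.subtype '' (Subtype.val ⁻¹' S)) (32 ^ r) := by
      rw [← nsum_image]; exact ⟨d, hd, rfl⟩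
    refine nsum_mono_left ?_ _ h1
    rintro _ ⟨x, hx, rfl⟩
    exact hx
  choose D hDX hDφ using hD
  -- coverings
  set X1 : Set R := nsum X 2 ∩ G with hX1
  have hsub : ∀ k, Cov (K ^ k) (nsum X (k + 1) ∩ G) X1 := by
    intro k
    refine Cov.of_rep ((nsum_cov hadd k).rep Set.inter_subset_left ?_)
    intro a ha a' ha' f h1 h2
    refine ⟨?_, G.sub_mem ha.2 ha'.2⟩
    rw [← nsum_one X] at h1 h2
    have := sub_mem_nsum hneg h1 h2
    simpa using this
  have hdbl : ∀ j : ℕ, Cov ((K ^ 3) ^ j) ((fun x => 2 ^ j • x) '' X1) X1 := by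
    intro j
    induction j with
    | zero => simpa using Cov.refl X1
    | succ j ih =>
      have h1 := cov_map (nsmulAddMonoidHom 2) ih
      have h2 := h1.trans ((hsub 3).mono le_rfl
        (A' := (nsmulAddMonoidHom 2 : R →+ R) '' X1) (by
        rintro _ ⟨x, hx, rfl⟩
        simp only [nsmulAddMonoidHom_apply]
        refine ⟨?_, G.nsmul_mem hx.2 2⟩
        rw [two_nsmul, show 3 + 1 = 2 + 2 from rfl, ← nsum_add]
        exact Set.add_mem_add hx.1 hx.1) subset_rfl)
      refine h2.mono (le_of_eq (by ring)) ?_ subset_rfl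
      rintro _ ⟨x, hx, rfl⟩
      refine ⟨2 ^ j • x, ⟨x, hx, rfl⟩, ?_⟩
      simp only [nsmulAddMonoidHom_apply]
      rw [← mul_smul, pow_succ']
  obtain ⟨F, hFc, hF⟩ : Cov (K ^ 20) ((fun x => 2 ^ 5 • x) '' X1 + (nsum X 4 ∩ G)) X1 := by
    have h1 := ((hdbl 5).add (Cov.refl (nsum X 4 ∩ (G : Set R)))).trans
      ((hsub 5).mono le_rfl (A' := X1 + (nsum X 4 ∩ (G : Set R))) (by
        intro z hz
        obtain ⟨x, hx, y, hy, rfl⟩ := Set.mem_add.1 hz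
        refine ⟨?_, G.add_mem hx.2 hy.2⟩
        rw [show 5 + 1 = 2 + 4 from rfl, ← nsum_add]
        exact Set.add_mem_add hx.1 hy.1) subset_rfl)
    exact h1.mono (le_of_eq (by ring)) subset_rfl subset_rfl
  -- counting
  let XG : Set G := Subtype.val ⁻¹' (nsum X 2)
  have hXG : XG.Finite := (nsum_finite hfin 2).preimage Subtype.val_injective.injOn
  let A : Finset (Fin r → ℤ) := hXG.toFinset.image ρ
  have hA : 0 < A.card := Finset.card_pos.2 ⟨ρ 0, Finset.mem_image_of_mem _
    (hXG.mem_toFinset.2 (zero_mem_nsum h0 2))⟩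
  let ρ' : R → (Fin r → ℤ) := fun f => if h : f ∈ G then ρ ⟨f, h⟩ else 0
  let B : Finset (Fin r → ℤ) := (F ×ˢ A).image (fun p => ρ' p.1 + p.2)
  have hB : B.card ≤ K ^ 20 * A.card :=
    Finset.card_image_le.trans (by rw [Finset.card_product]; exact Nat.mul_le_mul_right _ hFc)
  have hcount : (A ×ˢ (Finset.univ : Finset (Fin r → ZMod 32))).card ≤ B.card := by
    refine Finset.card_le_card_of_injOn (fun p => 32 • p.1 + ρ (D p.2)) ?_ ?_
    · rintro ⟨a, c⟩ hp
      obtain ⟨ha, -⟩ := Finset.mem_product.1 hp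
      obtain ⟨x, hx, rfl⟩ := Finset.mem_image.1 ha
      have hx' := hXG.mem_toFinset.1 hx
      obtain ⟨f, hf, hfx⟩ := hF (2 ^ 5 • (x : R) + (D c : R))
        (Set.add_mem_add ⟨x, ⟨hx', x.2⟩, rfl⟩ ⟨hDX c, (D c).2⟩)
      have hfG : f ∈ G := by
        have h1 : 2 ^ 5 • (x : R) + (D c : R) ∈ G := G.add_mem (G.nsmul_mem x.2 _) (D c).2
        have h2 := G.sub_mem h1 hfx.2
        simpa using h2
      refine Finset.mem_coe.2 (Finset.mem_image.2
        ⟨(f, ρ (2 ^ 5 • x + D c - ⟨f, hfG⟩)), Finset.mk_mem_product hf ?_, ?_⟩)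
      · refine Finset.mem_image_of_mem _ (hXG.mem_toFinset.2 ?_)
        exact hfx.1
      · simp only [ρ', dif_pos hfG]
        rw [← map_add, add_sub_cancel, map_add, map_nsmul]
        norm_num
    · rintro ⟨a, c⟩ - ⟨a', c'⟩ - h
      simp only at h
      have hc : c = c' := by
        have h1 := congrArg red h
        have e : ∀ z : Fin r → ℤ, red (32 • z) = 0 := by
          intro z
          funext i
          rw [map_nsmul]
          simp only [Pi.smul_apply, Pi.zero_apply, nsmul_eq_mul]
          have : ((32 : ℕ) : ZMod 32) = 0 := ZMod.natCast_self 32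
          rw [this, zero_mul]
        rw [map_add, map_add, e, e, zero_add, zero_add] at h1
        rw [← hDφ c, ← hDφ c']
        exact h1
      subst hc
      have h2 := add_right_cancel h
      have h3 : a = a' := by
        funext i
        have := congrFun h2 i
        simp only [Pi.smul_apply, nsmul_eq_mul] at this
        push_cast at this
        linarith
      rw [h3]
  have h4 : A.card * 32 ^ r ≤ K ^ 20 * A.card := by
    refine le_trans (le_of_eq ?_) (hcount.trans hB)
    rw [Finset.card_product]
    simp
  have h5 : 32 ^ r ≤ K ^ 20 := by
    rw [mul_comm] at h4
    exact Nat.le_of_mul_le_mul_right h4 hA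
  have h6 : (2 ^ r) ^ 5 ≤ (K ^ 4) ^ 5 := by
    rw [← pow_mul, ← pow_mul, mul_comm r 5, pow_mul]
    exact h5
  exact (Nat.pow_le_pow_iff_left (by norm_num)).1 h6

end rank

/-! ### Long words are torsion -/

lemma tors_hom (M : Type*) [AddCommGroup M] [Module.Finite ℤ M] :
    ∃ (d : ℕ) (ρ : M →ₗ[ℤ] (Fin d → ℤ)), ∀ x, ρ x = 0 → ∃ n : ℕ, n ≠ 0 ∧ n • x = 0 := by
  let b := Module.finBasis ℤ (M ⧸ Submodule.torsion ℤ M)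
  refine ⟨_, b.equivFun.toLinearMap ∘ₗ (Submodule.torsion ℤ M).mkQ, ?_⟩
  intro x hx
  simp only [LinearMap.coe_comp, LinearEquiv.coe_coe, Function.comp_apply,
    LinearEquiv.map_eq_zero_iff, Submodule.mkQ_apply, Submodule.Quotient.mk_eq_zero] at hx
  obtain ⟨⟨a, ha⟩, h⟩ := hx
  have ha0 : a ≠ 0 := nonZeroDivisors.ne_zero ha
  refine ⟨a.natAbs, Int.natAbs_ne_zero.2 ha0, ?_⟩
  have h' : a • x = 0 := h
  rcases Int.natAbs_eq a with e | e
  · rw [e, natCast_zsmul] at h'; exact h'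
  · rw [e, neg_smul, natCast_zsmul, neg_eq_zero] at h'; exact h'

section words
variable {R : Type u} [NonUnitalRing R]

lemma fg_closure {Z : Set R} (hZ : Z.Finite) : Module.Finite ℤ (AddSubgroup.closure Z) :=
  have : Finite Z := hZ
  Module.Finite.iff_addGroup_fg.2 (AddGroup.closure_finite_fg Z)

lemma torsion_of_divisible {Z : Set R} (hZ : Z.Finite) (E : Set R) (hE : E.Finite) :
    ∃ C : ℕ, ∀ w ∈ AddSubgroup.closure Z, ∀ M : ℕ, C ≤ M → M • w ∈ E →
      ∃ n : ℕ, n ≠ 0 ∧ n • w = 0 := by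
  classical
  have := fg_closure hZ
  obtain ⟨d, ρ, hρ⟩ := tors_hom (AddSubgroup.closure Z)
  let E' : Set (AddSubgroup.closure Z) := Subtype.val ⁻¹' E
  have hE' : E'.Finite := hE.preimage Subtype.val_injective.injOn
  refine ⟨(∑ e ∈ hE'.toFinset, ∑ i, (ρ e i).natAbs) + 1, ?_⟩
  intro w hw M hM hMw
  obtain ⟨n, hn, h⟩ := hρ ⟨w, hw⟩ (by
    funext i
    have hmem : M • (⟨w, hw⟩ : AddSubgroup.closure Z) ∈ hE'.toFinset := by
      rw [hE'.mem_toFinset]; exact hMw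
    have h1 : (ρ (M • (⟨w, hw⟩ : AddSubgroup.closure Z)) i).natAbs < M := by
      have h2 := Finset.single_le_sum (f := fun e => ∑ i, (ρ e i).natAbs)
        (fun _ _ => Nat.zero_le _) hmem
      have h3 := Finset.single_le_sum
        (f := fun i => (ρ (M • (⟨w, hw⟩ : AddSubgroup.closure Z)) i).natAbs)
        (fun _ _ => Nat.zero_le _) (Finset.mem_univ i)
      omega
    rw [map_nsmul, Pi.smul_apply, nsmul_eq_mul, Int.natAbs_mul, Int.natAbs_natCast] at h1
    by_contra hne
    have h4 : 1 ≤ (ρ ⟨w, hw⟩ i).natAbs := Int.natAbs_pos.2 hne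
    have := Nat.mul_le_mul_left M h4
    omega)
  exact ⟨n, hn, congrArg Subtype.val h⟩

lemma pigeon_mul (K : ℕ) (X : Set R) (h0 : (0 : R) ∈ X)
    (hneg : ∀ x ∈ X, -x ∈ X) (hadd : Cov K (X + X) X) (hmul : Cov K (X * X) X)
    (s v : R) (hs : ∀ k ≤ 2 * K ^ 31, k • s ∈ nsum X 4) (hv : v ∈ nsum X 4) :
    ∃ k : ℕ, 2 ≤ k ∧ k • (s * v) ∈ nsum X 4 := by
  classical
  obtain ⟨F, hFc, hF⟩ := mul_cov hadd hmul 4 4 15 rfl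
  replace hFc : F.card ≤ K ^ 31 := hFc
  have h1 : ∀ i : Fin (K ^ 31 + 1), ∃ f ∈ F, (2 * (i : ℕ)) • (s * v) - f ∈ X := by
    intro i
    refine hF _ ?_
    rw [← smul_mul_assoc]
    exact Set.mul_mem_mul (hs _ (by have := i.2; omega)) hv
  choose g hg hg' using h1
  obtain ⟨a, b, hab, he⟩ := Fintype.exists_ne_map_eq_of_card_lt
    (fun i => (⟨g i, hg i⟩ : F)) (by simp only [Fintype.card_coe, Fintype.card_fin]; omega)
  simp only [Subtype.mk.injEq] at he
  wlog hlt : a < b generalizing a b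
  · exact this b a hab.symm he.symm (lt_of_le_of_ne (not_lt.1 hlt) hab.symm)
  have hlt' : (a : ℕ) < b := hlt
  refine ⟨2 * b - 2 * a, by omega, ?_⟩
  rw [sub_nsmul _ (by omega), ← sub_eq_add_neg]
  have h2 := hg' b
  have h3 := hg' a
  rw [he] at h3
  rw [← nsum_one X] at h2 h3
  have h4 := sub_mem_nsum hneg h2 h3
  rw [sub_sub_sub_cancel_right] at h4
  exact nsum_mono h0 (by norm_num) h4

/-- words of length `n+1` in the elements of `S` -/
def words (S : Set R) : ℕ → Set R
  | 0 => S
  | n + 1 => S * words S n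

lemma words_mul (S : Set R) (n : ℕ) : words S n * S ⊆ words S (n + 1) := by
  induction n with
  | zero => exact subset_rfl
  | succ n ih =>
    rw [words, mul_assoc]
    exact Set.mul_subset_mul subset_rfl ih

lemma words_torsion (K : ℕ) (X : Set R) (hfin : X.Finite) (h0 : (0 : R) ∈ X)
    (hneg : ∀ x ∈ X, -x ∈ X) (hadd : Cov K (X + X) X) (hmul : Cov K (X * X) X)
    (T : NonUnitalSubring R) (Z : Set R) (hZ : Z.Finite)
    (hTZ : (T : Set R) ⊆ AddSubgroup.closure Z) (hK : 1 ≤ K)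
    (S : Set R) (hST : S ⊆ T) (hs : ∀ s ∈ S, ∀ k ≤ 2 * K ^ 31, k • s ∈ nsum X 4) :
    ∃ n0 : ℕ, ∀ n, n0 ≤ n → ∀ w ∈ words S n, ∃ k : ℕ, k ≠ 0 ∧ k • w = 0 := by
  obtain ⟨C, hC⟩ := torsion_of_divisible hZ (nsum X 4) (nsum_finite hfin 4)
  have hw : ∀ n, ∀ w ∈ words S n, w ∈ T ∧ ∃ M : ℕ, 2 ^ n ≤ M ∧ M • w ∈ nsum X 4 := by
    intro n
    induction n with
    | zero =>
      intro w hw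
      refine ⟨hST hw, 1, le_rfl, hs w hw 1 ?_⟩
      have : 0 < K ^ 31 := by positivity
      omega
    | succ n ih =>
      intro w hw
      obtain ⟨s, hsS, x, hx, rfl⟩ := Set.mem_mul.1 hw
      obtain ⟨hxT, M, hM, hMx⟩ := ih x hx
      obtain ⟨k, hk, hk'⟩ := pigeon_mul K X h0 hneg hadd hmul s (M • x) (hs s hsS) hMx
      refine ⟨mul_mem (hST hsS) hxT, k * M, ?_, ?_⟩
      · rw [pow_succ']; exact Nat.mul_le_mul hk hM
      · rwa [mul_smul_comm, ← mul_smul] at hk'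
  refine ⟨C, fun n hn w hwn => ?_⟩
  obtain ⟨hwT, M, hM, hMw⟩ := hw n w hwn
  exact hC w (hTZ hwT) M ((hn.trans Nat.lt_two_pow_self.le).trans hM) hMw

lemma filtration (S : Set R) (n0 : ℕ)
    (hS : ∀ n, n0 ≤ n → ∀ w ∈ words S n, ∃ k : ℕ, k ≠ 0 ∧ k • w = 0) :
    ∃ I : ℕ → AddSubgroup R, (∀ t ∈ NonUnitalSubring.closure S, t ∈ I 0) ∧
      (∀ t ∈ NonUnitalSubring.closure S, ∀ p, ∀ y ∈ I p, t * y ∈ I (p + 1) ∧ y * t ∈ I (p + 1)) ∧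
      ∀ y ∈ I n0, ∃ k : ℕ, k ≠ 0 ∧ k • y = 0 := by
  let U : ℕ → Set R := fun p => {w | ∃ q, p ≤ q ∧ w ∈ words S q}
  let I : ℕ → AddSubgroup R := fun p => AddSubgroup.closure (U p)
  have hI : ∀ p, I (p + 1) ≤ I p := fun p => AddSubgroup.closure_mono (by
    rintro w ⟨q, hq, hw⟩
    exact ⟨q, by omega, hw⟩)
  have hgen : ∀ s ∈ S, ∀ p, ∀ y ∈ I p, s * y ∈ I (p + 1) ∧ y * s ∈ I (p + 1) := by
    intro s hs p y hy
    induction hy using AddSubgroup.closure_induction with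
    | mem w hw =>
      obtain ⟨q, hq, hw⟩ := hw
      exact ⟨AddSubgroup.subset_closure ⟨q + 1, by omega, Set.mul_mem_mul hs hw⟩,
        AddSubgroup.subset_closure ⟨q + 1, by omega, words_mul S q (Set.mul_mem_mul hw hs)⟩⟩
    | zero => simp
    | add a b _ _ ha hb =>
      rw [mul_add, add_mul]
      exact ⟨add_mem ha.1 hb.1, add_mem ha.2 hb.2⟩
    | neg a _ ha =>
      rw [mul_neg, neg_mul]
      exact ⟨neg_mem ha.1, neg_mem ha.2⟩
  have hmain : ∀ t ∈ NonUnitalSubring.closure S, t ∈ I 0 ∧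
      ∀ p, ∀ y ∈ I p, t * y ∈ I (p + 1) ∧ y * t ∈ I (p + 1) := by
    intro t ht
    induction ht using NonUnitalSubring.closure_induction with
    | mem s hs => exact ⟨AddSubgroup.subset_closure ⟨0, le_rfl, hs⟩, hgen s hs⟩
    | zero => exact ⟨zero_mem _, fun p y _ => by simp⟩
    | add a b _ _ ha hb =>
      refine ⟨add_mem ha.1 hb.1, fun p y hy => ?_⟩
      rw [mul_add, add_mul]
      exact ⟨add_mem (ha.2 p y hy).1 (hb.2 p y hy).1, add_mem (ha.2 p y hy).2 (hb.2 p y hy).2⟩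
    | neg a _ ha =>
      refine ⟨neg_mem ha.1, fun p y hy => ?_⟩
      rw [mul_neg, neg_mul]
      exact ⟨neg_mem (ha.2 p y hy).1, neg_mem (ha.2 p y hy).2⟩
    | mul a b _ _ ha hb =>
      refine ⟨hI 0 (ha.2 0 b hb.1).1, fun p y hy => ⟨?_, ?_⟩⟩
      · rw [mul_assoc]; exact hI _ (ha.2 _ _ (hb.2 p y hy).1).1
      · rw [← mul_assoc]; exact hI _ (hb.2 _ _ (ha.2 p y hy).2).2
  refine ⟨I, fun t ht => (hmain t ht).1, fun t ht => (hmain t ht).2, ?_⟩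
  intro y hy
  induction hy using AddSubgroup.closure_induction with
  | mem w hw =>
    obtain ⟨q, hq, hw⟩ := hw
    exact hS q hq w hw
  | zero => exact ⟨1, one_ne_zero, by simp⟩
  | add a b _ _ ha hb =>
    obtain ⟨n, hn, h1⟩ := ha
    obtain ⟨m, hm, h2⟩ := hb
    refine ⟨n * m, mul_ne_zero hn hm, ?_⟩
    rw [smul_add, mul_smul n m b, h2, smul_zero, mul_comm, mul_smul, h1, smul_zero, add_zero]
  | neg a _ ha =>
    obtain ⟨n, hn, h1⟩ := ha
    exact ⟨n, hn, by rw [smul_neg, h1, neg_zero]⟩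

end words

/-! ### Construction of the nilpotent ideal -/

section ideal
variable {R : Type u} [NonUnitalRing R]

/-- elements having a non-zero multiple in `P` -/
def satur (P : AddSubgroup R) : AddSubgroup R where
  carrier := {t | ∃ n : ℕ, n ≠ 0 ∧ n • t ∈ P}
  zero_mem' := ⟨1, one_ne_zero, by simp⟩
  add_mem' := by
    rintro a b ⟨n, hn, h1⟩ ⟨m, hm, h2⟩
    refine ⟨n * m, mul_ne_zero hn hm, ?_⟩
    rw [smul_add]
    refine add_mem ?_ ?_
    · rw [mul_comm, mul_smul]; exact P.nsmul_mem h1 m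
    · rw [mul_smul]; exact P.nsmul_mem h2 n
  neg_mem' := by
    rintro a ⟨n, hn, h1⟩
    exact ⟨n, hn, by rw [smul_neg]; exact neg_mem h1⟩

lemma mem_satur {P : AddSubgroup R} {t : R} : t ∈ satur P ↔ ∃ n : ℕ, n ≠ 0 ∧ n • t ∈ P := Iff.rfl

lemma unif_satur {ι : Type*} (A : Finset ι) (f : ι → R →+ R) (P : ι → AddSubgroup R)
    (Z : Set R) (hZ : Z.Finite) (h : ∀ i ∈ A, ∀ z ∈ Z, f i z ∈ satur (P i)) :
    ∃ D : ℕ, D ≠ 0 ∧ ∀ i ∈ A, ∀ t ∈ AddSubgroup.closure Z, D • f i t ∈ P i := by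
  classical
  have h' : ∀ p : ι × R, ∃ n : ℕ, n ≠ 0 ∧ (p ∈ A ×ˢ hZ.toFinset → n • f p.1 p.2 ∈ P p.1) := by
    intro p
    by_cases hp : p ∈ A ×ˢ hZ.toFinset
    · obtain ⟨h1, h2⟩ := Finset.mem_product.1 hp
      obtain ⟨n, hn, h3⟩ := h p.1 h1 p.2 (hZ.mem_toFinset.1 h2)
      exact ⟨n, hn, fun _ => h3⟩
    · exact ⟨1, one_ne_zero, fun h => absurd h hp⟩
  choose n hn hn' using h'
  refine ⟨∏ p ∈ A ×ˢ hZ.toFinset, n p, Finset.prod_ne_zero_iff.2 fun p _ => hn p, ?_⟩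
  intro i hi t ht
  induction ht using AddSubgroup.closure_induction with
  | mem z hz =>
    have hp : (i, z) ∈ A ×ˢ hZ.toFinset := Finset.mk_mem_product hi (hZ.mem_toFinset.2 hz)
    obtain ⟨c, hc⟩ := Finset.dvd_prod_of_mem n hp
    rw [hc, mul_comm, mul_smul]
    exact (P i).nsmul_mem (hn' _ hp) c
  | zero => simp
  | add a b _ _ ha hb => rw [map_add, smul_add]; exact add_mem ha hb
  | neg a _ ha => rw [map_neg, smul_neg]; exact neg_mem ha

/-- the additive group generated by the first `i` terms of a sequence -/
def spanTo (w : ℕ → R) (i : ℕ) : AddSubgroup R := AddSubgroup.closure (w '' Set.Iio i)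

lemma mem_spanTo (w : ℕ → R) {i j : ℕ} (h : j < i) : w j ∈ spanTo w i :=
  AddSubgroup.subset_closure ⟨j, h, rfl⟩

lemma spanTo_mono (w : ℕ → R) {i j : ℕ} (h : i ≤ j) : spanTo w i ≤ spanTo w j :=
  AddSubgroup.closure_mono (Set.image_mono (Set.Iio_subset_Iio h))

lemma satur_mono {P Q : AddSubgroup R} (h : P ≤ Q) : satur P ≤ satur Q := by
  rintro x ⟨n, hn, hx⟩
  exact ⟨n, hn, h hx⟩

lemma exists_seq (B : NonUnitalSubring R) (I : ℕ → AddSubgroup R) (n0 n : ℕ)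
    (hI0 : ∀ t ∈ B, t ∈ I 0)
    (hI : ∀ t ∈ B, ∀ p, ∀ y ∈ I p, t * y ∈ I (p + 1) ∧ y * t ∈ I (p + 1))
    (hIn : ∀ y ∈ I n0, ∃ k : ℕ, k ≠ 0 ∧ k • y = 0)
    (hrank : ∀ v : Fin (n + 1) → R, (∀ i, v i ∈ B) → ¬ LinearIndependent ℤ v) :
    ∃ w : ℕ → R, (∀ i, w i ∈ B) ∧ (∀ t ∈ B, t ∈ satur (spanTo w n)) ∧
      ∀ i, ∀ t ∈ B, t * w i ∈ satur (spanTo w i) ∧ w i * t ∈ satur (spanTo w i) := by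
  classical
  let Good : ℕ → Prop := fun k => ∃ w : ℕ → R, (∀ i, w i ∈ B) ∧
    LinearIndependent ℤ (fun i : Fin k => w i) ∧
    ∀ i, ∀ t ∈ B, t * w i ∈ satur (spanTo w i) ∧ w i * t ∈ satur (spanTo w i)
  have hG0 : Good 0 := ⟨fun _ => 0, fun _ => zero_mem _, linearIndependent_empty_type,
    fun i t _ => by simp⟩
  have hGn : ¬ Good (n + 1) := by
    rintro ⟨w, h1, h2, -⟩
    exact hrank _ (fun i => h1 i) h2
  obtain ⟨k, hk, hGk, hGk'⟩ : ∃ k, k ≤ n ∧ Good k ∧ ¬ Good (k + 1) := by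
    by_contra hcon
    push Not at hcon
    have : ∀ k, k ≤ n + 1 → Good k := by
      intro k
      induction k with
      | zero => exact fun _ => hG0
      | succ k ih => exact fun h => hcon k (by omega) (ih (by omega))
    exact hGn (this _ le_rfl)
  obtain ⟨w, hwB, hwl, hwm⟩ := hGk
  refine ⟨w, hwB, ?_, hwm⟩
  suffices h : ∀ t ∈ B, t ∈ satur (spanTo w k) from
    fun t ht => satur_mono (spanTo_mono w hk) (h t ht)
  by_contra hcon
  push Not at hcon
  obtain ⟨t0, ht0, ht0'⟩ := hcon
  have hex : ∃ p, ∀ y ∈ B, y ∈ I p → y ∈ satur (spanTo w k) := by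
    refine ⟨n0, fun y _ hy => ?_⟩
    obtain ⟨m, hm, h⟩ := hIn y hy
    exact ⟨m, hm, by rw [h]; exact zero_mem _⟩
  obtain ⟨p, hp⟩ : ∃ p, Nat.find hex = p + 1 := by
    refine Nat.exists_eq_succ_of_ne_zero fun h => ?_
    have := Nat.find_spec hex
    rw [h] at this
    exact ht0' (this t0 ht0 (hI0 t0 ht0))
  have hp1 := Nat.find_spec hex
  rw [hp] at hp1
  have hp2 := Nat.find_min hex (m := p) (by omega)
  push Not at hp2
  obtain ⟨x, hxB, hxI, hx⟩ := hp2
  refine hGk' ⟨fun i => if i < k then w i else if i = k then x else 0, ?_, ?_, ?_⟩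
  · intro i
    simp only
    split_ifs
    · exact hwB i
    · exact hxB
    · exact zero_mem _
  · rw [Fintype.linearIndependent_iff] at hwl ⊢
    intro g hg
    rw [Fin.sum_univ_castSucc] at hg
    simp only [Fin.val_castSucc, Fin.is_lt, if_true, Fin.val_last, lt_irrefl, if_false] at hg
    have hlast : g (Fin.last k) = 0 := by
      by_contra hne
      apply hx
      have hmem : g (Fin.last k) • x ∈ spanTo w k := by
        rw [← neg_eq_iff_add_eq_zero] at hg
        rw [← hg]
        exact neg_mem (sum_mem fun i _ => AddSubgroup.zsmul_mem _ (mem_spanTo w i.2) _)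
      refine ⟨(g (Fin.last k)).natAbs, Int.natAbs_ne_zero.2 hne, ?_⟩
      rw [← natCast_zsmul]
      rcases Int.natAbs_eq (g (Fin.last k)) with e | e
      · rw [← e]; exact hmem
      · have e' : ((g (Fin.last k)).natAbs : ℤ) = - g (Fin.last k) := by omega
        rw [e', neg_smul]; exact neg_mem hmem
    rw [hlast, zero_smul, add_zero] at hg
    intro i
    refine Fin.lastCases hlast (fun j => ?_) i
    exact hwl (fun j => g j.castSucc) hg j
  · have hspan : ∀ i, i ≤ k →
        spanTo (fun i => if i < k then w i else if i = k then x else 0) i = spanTo w i := by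
      intro i hi
      unfold spanTo
      congr 1
      refine Set.image_congr fun j hj => ?_
      have : j < k := lt_of_lt_of_le hj hi
      simp [this]
    intro i t ht
    rcases lt_trichotomy i k with hik | rfl | hik
    · rw [hspan i hik.le]
      simp only [hik, if_true]
      exact hwm i t ht
    · rw [hspan i le_rfl]
      simp only [lt_irrefl, if_false, if_true]
      exact ⟨hp1 _ (mul_mem ht hxB) (hI t ht p x hxI).1, hp1 _ (mul_mem hxB ht) (hI t ht p x hxI).2⟩
    · have h1 : ¬ i < k := by omega
      have h2 : i ≠ k := by omega
      simp [h1, h2]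

lemma finite_index (Z : Set R) (hZ : Z.Finite) (J : AddSubgroup R) (N : ℕ) (hN : N ≠ 0)
    (h : ∀ t ∈ AddSubgroup.closure Z, N • t ∈ J) :
    ∃ F : Finset R, (AddSubgroup.closure Z : Set R) ⊆ (F : Set R) + (J : Set R) := by
  classical
  let mk := QuotientAddGroup.mk' J
  let L : AddSubgroup (R ⧸ J) := AddSubgroup.closure (mk '' Z)
  have : Finite (mk '' Z) := hZ.image _
  have hL : Module.Finite ℤ L := Module.Finite.iff_addGroup_fg.2 (AddGroup.closure_finite_fg _)
  have hLZ : L = (AddSubgroup.closure Z).map mk := (AddMonoidHom.map_closure mk Z).symm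
  have htor : Module.IsTorsion ℤ L := by
    rintro ⟨x, hx⟩
    rw [hLZ] at hx
    obtain ⟨t, ht, rfl⟩ := hx
    refine ⟨⟨(N : ℤ), mem_nonZeroDivisors_of_ne_zero (by exact_mod_cast hN)⟩, ?_⟩
    apply Subtype.ext
    change (N : ℤ) • mk t = 0
    rw [natCast_zsmul, ← map_nsmul]
    exact (QuotientAddGroup.eq_zero_iff _).2 (h t ht)
  have hfin : Finite L := Module.finite_of_fg_torsion L htor
  have := Fintype.ofFinite L
  refine ⟨(Finset.univ : Finset L).image (fun l => Quotient.out l.1), ?_⟩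
  intro t ht
  have hmem : mk t ∈ L := by rw [hLZ]; exact ⟨t, ht, rfl⟩
  refine Set.mem_add.2 ⟨Quotient.out (mk t), ?_, -(Quotient.out (mk t)) + t, ?_, by abel⟩
  · exact Finset.mem_coe.2 (Finset.mem_image.2 ⟨⟨mk t, hmem⟩, Finset.mem_univ _, rfl⟩)
  · rw [SetLike.mem_coe, ← QuotientAddGroup.eq]
    exact Quotient.out_eq' (mk t)

lemma exists_ideal (B : NonUnitalSubring R) (Z : Set R) (hZ : Z.Finite)
    (hBZ : (B : Set R) = AddSubgroup.closure Z) (I : ℕ → AddSubgroup R) (n0 n : ℕ)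
    (hI0 : ∀ t ∈ B, t ∈ I 0)
    (hI : ∀ t ∈ B, ∀ p, ∀ y ∈ I p, t * y ∈ I (p + 1) ∧ y * t ∈ I (p + 1))
    (hIn : ∀ y ∈ I n0, ∃ k : ℕ, k ≠ 0 ∧ k • y = 0)
    (hrank : ∀ v : Fin (n + 1) → R, (∀ i, v i ∈ B) → ¬ LinearIndependent ℤ v) :
    ∃ J : Set R, IsTwoSidedIdealIn J (B : Set R) ∧
      (∃ F : Finset R, (B : Set R) ⊆ (F : Set R) + J) ∧ IsNNilpotentSet n J ∧
      mulIter J n ⊆ {0} := by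
  classical
  obtain ⟨w, hwB, hwt, hwm⟩ := exists_seq B I n0 n hI0 hI hIn hrank
  have hB : ∀ t, t ∈ B ↔ t ∈ AddSubgroup.closure Z := fun t => by
    rw [← SetLike.mem_coe, hBZ, SetLike.mem_coe]
  have hZB : ∀ z ∈ Z, z ∈ B := fun z hz => (hB z).2 (AddSubgroup.subset_closure hz)
  obtain ⟨D1, hD1, h1⟩ := unif_satur (Finset.range n) (fun i => AddMonoidHom.mulRight (w i))
    (fun i => spanTo w i) Z hZ (fun i _ z hz => (hwm i z (hZB z hz)).1)
  obtain ⟨D2, hD2, h2⟩ := unif_satur (Finset.range n) (fun i => AddMonoidHom.mulLeft (w i))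
    (fun i => spanTo w i) Z hZ (fun i _ z hz => (hwm i z (hZB z hz)).2)
  obtain ⟨D3, hD3, h3⟩ := unif_satur (Finset.range 1) (fun _ => AddMonoidHom.id R)
    (fun _ => spanTo w n) Z hZ (fun i _ z hz => hwt z (hZB z hz))
  obtain ⟨D, hD, hl, hr, hs⟩ : ∃ D : ℕ, D ≠ 0 ∧
      (∀ i < n, ∀ t ∈ B, D • (t * w i) ∈ spanTo w i) ∧
      (∀ i < n, ∀ t ∈ B, D • (w i * t) ∈ spanTo w i) ∧ ∀ t ∈ B, D • t ∈ spanTo w n := by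
    refine ⟨D1 * D2 * D3, mul_ne_zero (mul_ne_zero hD1 hD2) hD3, ?_, ?_, ?_⟩
    · intro i hi t ht
      rw [show D1 * D2 * D3 = (D2 * D3) * D1 by ring, mul_smul]
      exact AddSubgroup.nsmul_mem _ (h1 i (Finset.mem_range.2 hi) t ((hB t).1 ht)) _
    · intro i hi t ht
      rw [show D1 * D2 * D3 = (D1 * D3) * D2 by ring, mul_smul]
      exact AddSubgroup.nsmul_mem _ (h2 i (Finset.mem_range.2 hi) t ((hB t).1 ht)) _
    · intro t ht
      rw [mul_smul]
      exact AddSubgroup.nsmul_mem _ (h3 0 (by simp) t ((hB t).1 ht)) _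
  let u : ℕ → R := fun i => D ^ (i + 1) • w i
  have huB : ∀ i, u i ∈ B := fun i => nsmul_mem (hwB i) _
  have hWU : ∀ i, ∀ x ∈ spanTo w i, D ^ i • x ∈ spanTo u i := by
    intro i x hx
    induction hx using AddSubgroup.closure_induction with
    | mem y hy =>
      obtain ⟨j, hj, rfl⟩ := hy
      have hj' : j < i := hj
      have e : D ^ i • w j = D ^ (i - (j + 1)) • u j := by
        simp only [u]
        rw [← mul_smul, ← pow_add]
        congr 2
        omega
      rw [e]
      exact AddSubgroup.nsmul_mem _ (mem_spanTo u hj') _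
    | zero => rw [smul_zero]; exact zero_mem _
    | add a b _ _ ha hb => rw [smul_add]; exact add_mem ha hb
    | neg a _ ha => rw [smul_neg]; exact neg_mem ha
  have hul : ∀ i < n, ∀ t ∈ B, t * u i ∈ spanTo u i := by
    intro i hi t ht
    simp only [u]
    rw [mul_smul_comm, pow_succ, mul_smul]
    exact hWU i _ (hl i hi t ht)
  have hur : ∀ i < n, ∀ t ∈ B, u i * t ∈ spanTo u i := by
    intro i hi t ht
    simp only [u]
    rw [smul_mul_assoc, pow_succ, mul_smul]
    exact hWU i _ (hr i hi t ht)
  have hJB : ∀ x ∈ spanTo u n, x ∈ B := by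
    intro x hx
    induction hx using AddSubgroup.closure_induction with
    | mem y hy => obtain ⟨j, -, rfl⟩ := hy; exact huB j
    | zero => exact zero_mem _
    | add a b _ _ ha hb => exact add_mem ha hb
    | neg a _ ha => exact neg_mem ha
  -- multiplication lowers the filtration
  have hlow : ∀ q, q ≤ n → ∀ x ∈ spanTo u q, ∀ t ∈ B,
      t * x ∈ spanTo u (q - 1) ∧ x * t ∈ spanTo u (q - 1) := by
    intro q hq x hx t ht
    induction hx using AddSubgroup.closure_induction with
    | mem y hy =>
      obtain ⟨j, hj, rfl⟩ := hy
      have hj' : j < q := hj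
      exact ⟨spanTo_mono u (by omega) (hul j (by omega) t ht),
        spanTo_mono u (by omega) (hur j (by omega) t ht)⟩
    | zero => simp
    | add a b _ _ ha hb =>
      rw [mul_add, add_mul]; exact ⟨add_mem ha.1 hb.1, add_mem ha.2 hb.2⟩
    | neg a _ ha => rw [mul_neg, neg_mul]; exact ⟨neg_mem ha.1, neg_mem ha.2⟩
  have hideal : ∀ t ∈ B, ∀ x ∈ spanTo u n, t * x ∈ spanTo u n ∧ x * t ∈ spanTo u n := by
    intro t ht x hx
    obtain ⟨h4, h5⟩ := hlow n le_rfl x hx t ht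
    exact ⟨spanTo_mono u (Nat.sub_le _ _) h4, spanTo_mono u (Nat.sub_le _ _) h5⟩
  refine ⟨spanTo u n, ⟨hJB, zero_mem _, fun x hx y hy => add_mem hx hy, fun x hx => neg_mem hx,
    hideal⟩, ?_, ⟨fun i => u i, ?_, ?_⟩, ?_⟩
  · rw [hBZ]
    refine finite_index Z hZ _ (D ^ (n + 1)) (pow_ne_zero _ hD) ?_
    intro t ht
    rw [pow_succ, mul_smul]
    exact hWU n _ (hs t ((hB t).2 ht))
  · have hrange : Set.range (fun i : Fin n => u i) = u '' Set.Iio n := by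
      ext x
      constructor
      · rintro ⟨i, rfl⟩; exact ⟨i, i.2, rfl⟩
      · rintro ⟨i, hi, rfl⟩; exact ⟨⟨i, hi⟩, rfl⟩
    rw [hrange]
    apply Set.Subset.antisymm
    · intro x hx
      induction hx using NonUnitalSubring.closure_induction with
      | mem y hy => exact AddSubgroup.subset_closure hy
      | zero => exact zero_mem _
      | add a b _ _ ha hb => exact add_mem ha hb
      | neg a _ ha => exact neg_mem ha
      | mul a b _ _ ha hb => exact (hideal a (hJB a ha) b hb).1
    · intro x hx
      induction hx using AddSubgroup.closure_induction with
      | mem y hy => exact NonUnitalSubring.subset_closure hy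
      | zero => exact zero_mem _
      | add a b _ _ ha hb => exact add_mem ha hb
      | neg a _ ha => exact neg_mem ha
  · have hsub : ∀ i : Fin n, ∀ x ∈ spanTo u i,
        x ∈ NonUnitalSubring.closure ((fun i : Fin n => u i) '' {k : Fin n | k < i}) := by
      intro i x hx
      induction hx using AddSubgroup.closure_induction with
      | mem y hy =>
        obtain ⟨j, hj, rfl⟩ := hy
        have hj' : j < i := hj
        exact NonUnitalSubring.subset_closure ⟨⟨j, hj'.trans i.2⟩, hj', rfl⟩
      | zero => exact zero_mem _
      | add a b _ _ ha hb => exact add_mem ha hb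
      | neg a _ ha => exact neg_mem ha
    intro i j _
    exact ⟨hsub i _ (hur i i.2 _ (huB j)), hsub i _ (hul i i.2 _ (huB j))⟩
  · have hit : ∀ p, mulIter (spanTo u n : Set R) p ⊆ spanTo u (n - p) := by
      intro p
      induction p with
      | zero => exact subset_rfl
      | succ p ih =>
        intro x hx
        obtain ⟨a, ha, b, hb, rfl⟩ := Set.mem_mul.1 hx
        exact (hlow (n - p) (Nat.sub_le _ _) a (ih ha) b (hJB b hb)).2
    intro x hx
    have := hit n hx
    rw [Nat.sub_self] at this
    simpa [spanTo] using this

end ideal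

/-! ### The main theorem -/

lemma fg_of_le {R : Type u} [NonUnitalRing R] (B : NonUnitalSubring R) (Z : Set R) (hZ : Z.Finite)
    (hBZ : (B : Set R) ⊆ AddSubgroup.closure Z) :
    ∃ Z' : Set R, Z'.Finite ∧ (B : Set R) = AddSubgroup.closure Z' := by
  have h1 : (Submodule.span ℤ Z).FG := ⟨hZ.toFinset, by simp⟩
  have h2 : AddSubgroup.toIntSubmodule B.toAddSubgroup ≤ Submodule.span ℤ Z := by
    intro x hx
    have := hBZ hx
    rw [← Submodule.span_int_eq_addSubgroupClosure] at this
    exact this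
  obtain ⟨Z', hZ'⟩ := Submodule.FG.of_le h1 h2
  refine ⟨Z', Z'.finite_toSet, ?_⟩
  rw [← Submodule.span_int_eq_addSubgroupClosure, hZ']
  rfl

lemma indep_scale {R : Type u} [NonUnitalRing R] {r : ℕ} (v : Fin r → R)
    (hv : LinearIndependent ℤ v) (c : Fin r → ℕ) (hc : ∀ i, c i ≠ 0) :
    LinearIndependent ℤ (fun i => c i • v i) := by
  rw [Fintype.linearIndependent_iff] at hv ⊢
  intro g hg i
  have h := hv (fun i => g i * c i) (by
    rw [← hg]
    refine Finset.sum_congr rfl fun i _ => ?_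
    rw [mul_smul, natCast_zsmul]) i
  rcases mul_eq_zero.1 h with h | h
  · exact h
  · exact absurd (by exact_mod_cast h) (hc i)

lemma two_pow_floor (K : ℕ) (hK : 1 ≤ K) :
    K ^ 4 < 2 ^ (Nat.floor ((4 : ℝ) * Real.logb 2 (K : ℝ)) + 1) := by
  have h := Nat.lt_floor_add_one ((4 : ℝ) * Real.logb 2 (K : ℝ))
  have hK' : (0 : ℝ) < K := by exact_mod_cast hK
  have h1 : (4 : ℝ) * Real.logb 2 (K : ℝ) = Real.logb 2 ((K : ℝ) ^ 4) := by
    rw [Real.logb_pow]; norm_num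
  rw [h1] at h ⊢
  rw [Real.logb_lt_iff_lt_rpow (by norm_num) (by positivity)] at h
  have h2 : (K : ℝ) ^ 4 < (2 : ℝ) ^ (Nat.floor (Real.logb 2 ((K : ℝ) ^ 4)) + 1) := by
    have e : ((Nat.floor (Real.logb 2 ((K : ℝ) ^ 4)) : ℝ) + 1)
        = ((Nat.floor (Real.logb 2 ((K : ℝ) ^ 4)) + 1 : ℕ) : ℝ) := by push_cast; rfl
    rw [e, Real.rpow_natCast] at h
    exact h
  exact_mod_cast h2

lemma main_aux (K n : ℕ) (hK : 1 ≤ K) (hn : K ^ 4 < 2 ^ (n + 1)) :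
    ∃ N : ℕ, ∀ (R : Type u) [NonUnitalRing R] (X : Set R),
      X.Finite → IsApproxSubringWith K X →
      ∃ Y : Set R,
        Y ⊆ nsum X 2 ∧ Y.Finite ∧
        IsApproxSubringWith (K ^ 510 + K ^ 22) Y ∧
        NCommensurable N Y X ∧
        ∃ J : Set R,
          IsTwoSidedIdealIn J (NonUnitalSubring.closure Y : Set R) ∧
          (∃ F : Finset R, (NonUnitalSubring.closure Y : Set R) ⊆ (F : Set R) + J) ∧
          IsNNilpotentSet n J ∧ mulIter J n ⊆ {0} := by
  classical
  set m : ℕ := 32 ^ (n + 1) + 8 * K ^ 31 with hm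
  have hKp : 0 < K ^ 31 := by positivity
  have hmp : 0 < 32 ^ (n + 1) := by positivity
  obtain ⟨N0, hN0⟩ := sanders.{u} K m hK (by omega)
  set N1 : ℕ := (N0 * (K ^ 7 * N0) ^ (K ^ 3)) * (K ^ 6 * N0) ^ (K ^ 7 * N0) with hN1
  refine ⟨max K (N0 * (K ^ 3 * N1)), ?_⟩
  intro R _ X hfin hX
  obtain ⟨⟨h0, hsym⟩, F, hFc, hF⟩ := hX
  have hneg : ∀ x ∈ X, -x ∈ X := by
    intro x hx
    rw [hsym] at hx
    exact hx
  have hadd : Cov K (X + X) X := cov_iff.2 ⟨F, hFc, Set.subset_union_right.trans hF⟩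
  have hmul : Cov K (X * X) X := cov_iff.2 ⟨F, hFc, Set.subset_union_left.trans hF⟩
  obtain ⟨S, hS0, hSneg, hSX2, hSm, hSc⟩ := hN0 R X hfin h0 hneg hadd
  have hSf : S.Finite := (nsum_finite hfin 2).subset hSX2
  set G := AddSubgroup.closure S with hG
  have hS2G : nsum S 2 ⊆ G := nsum_sub_closure S 2
  have hGc : AddSubgroup.closure (nsum X 2 ∩ G) = G := by
    apply le_antisymm
    · rw [AddSubgroup.closure_le]; exact Set.inter_subset_right
    · rw [hG, AddSubgroup.closure_le]
      intro s hs
      exact AddSubgroup.subset_closure ⟨hSX2 hs, AddSubgroup.subset_closure hs⟩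
  obtain ⟨T, hTc, ⟨Z, hZ, hTZ⟩, hTt⟩ := ring_step K N0 X hfin h0 hneg hadd hmul G hGc
    (hSc.mono le_rfl subset_rfl hS2G)
  set S2 : Set R := nsum S 4 ∩ T with hS2
  have hS2c : Cov (N0 * (K ^ 3 * N1)) X S2 := by
    refine hSc.trans (Cov.of_rep (((nsum_cov hadd 3).trans hTc).rep (A' := nsum S 2) ?_ ?_))
    · exact (nsum_mono hS0 (by omega)).trans hSm
    · intro a ha a' ha' f h1 h2
      refine ⟨sub_mem_nsum hSneg ha ha', ?_⟩
      have := T.sub_mem h1 h2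
      simpa using this
  set T2 : NonUnitalSubring R := NonUnitalSubring.closure S2 with hT2
  have hT2T : T2 ≤ T := NonUnitalSubring.closure_le.2 Set.inter_subset_right
  set Y : Set R := nsum X 2 ∩ T2 with hY
  have hYfin : Y.Finite := (nsum_finite hfin 2).subset Set.inter_subset_left
  have hdiff : ∀ a ∈ T2, ∀ a' ∈ T2, ∀ f, a - f ∈ X → a' - f ∈ X → a - a' ∈ Y := by
    intro a ha a' ha' f h1 h2
    refine ⟨?_, T2.sub_mem ha ha'⟩
    rw [← nsum_one X] at h1 h2
    have := sub_mem_nsum hneg h1 h2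
    simpa using this
  have hYc : Cov (N0 * (K ^ 3 * N1)) X Y := by
    refine Cov.of_rep ((hS2c.mono le_rfl subset_rfl
      (NonUnitalSubring.subset_closure : S2 ⊆ (T2 : Set R))).rep subset_rfl ?_)
    intro a ha a' ha' f h1 h2
    constructor
    · rw [← nsum_one X] at ha ha'
      have := sub_mem_nsum hneg ha ha'
      simpa using this
    · have := T2.sub_mem h1 h2
      simpa using this
  refine ⟨Y, Set.inter_subset_left, hYfin, ⟨⟨⟨zero_mem_nsum h0 2, zero_mem _⟩, ?_⟩, ?_⟩,
    ⟨?_, ?_⟩, ?_⟩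
  · have hYneg : ∀ y ∈ Y, -y ∈ Y := fun y hy => ⟨neg_mem_nsum hneg 2 y hy.1, T2.neg_mem hy.2⟩
    ext y
    rw [Set.mem_neg]
    exact ⟨hYneg y, fun h => by simpa using hYneg _ h⟩
  · obtain ⟨F1, hF1c, -, hF1⟩ := (mul_cov hadd hmul 2 2 3 rfl).rep
      (A' := nsum X 2 * nsum X 2 ∩ T2) (C := Y) Set.inter_subset_left
      (fun a ha a' ha' => hdiff a ha.2 a' ha'.2)
    obtain ⟨F2, hF2c, -, hF2⟩ := (nsum_cov hadd 3).rep
      (A' := nsum X 4 ∩ T2) (C := Y) Set.inter_subset_left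
      (fun a ha a' ha' => hdiff a ha.2 a' ha'.2)
    refine ⟨F1 ∪ F2, ?_, ?_⟩
    · refine (Finset.card_union_le _ _).trans (Nat.add_le_add ?_ ?_)
      · exact hF1c.trans (Nat.pow_le_pow_right hK (by norm_num))
      · exact hF2c.trans (Nat.pow_le_pow_right hK (by norm_num))
    · rintro z (hz | hz)
      · obtain ⟨a, ha, b, hb, rfl⟩ := Set.mem_mul.1 hz
        obtain ⟨f, hf, h⟩ := hF1 _ ⟨Set.mul_mem_mul ha.1 hb.1, T2.mul_mem ha.2 hb.2⟩
        exact Set.mem_add.2 ⟨f, Finset.mem_coe.2 (Finset.mem_union_left _ hf), _, h, by abel⟩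
      · obtain ⟨a, ha, b, hb, rfl⟩ := Set.mem_add.1 hz
        obtain ⟨f, hf, h⟩ := hF2 (a + b) ⟨by
          rw [show 4 = 2 + 2 from rfl, ← nsum_add]
          exact Set.add_mem_add ha.1 hb.1, T2.add_mem ha.2 hb.2⟩
        exact Set.mem_add.2 ⟨f, Finset.mem_coe.2 (Finset.mem_union_right _ hf), _, h, by abel⟩
  · have := nsum_cov hadd 1
    rw [pow_one] at this
    exact cov_iff.1 (this.mono (le_max_left _ _) Set.inter_subset_left subset_rfl)
  · exact cov_iff.1 (hYc.mono (le_max_right _ _) subset_rfl subset_rfl)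
  · have hY2 : NonUnitalSubring.closure Y ≤ T2 :=
      NonUnitalSubring.closure_le.2 Set.inter_subset_right
    obtain ⟨Z', hZ', hBZ'⟩ := fg_of_le (NonUnitalSubring.closure Y) Z hZ
      (fun x hx => hTZ (hT2T (hY2 hx)))
    obtain ⟨n0, hn0⟩ := words_torsion K X hfin h0 hneg hadd hmul T Z hZ hTZ hK S2
      Set.inter_subset_right (by
        intro s hs k hk
        apply hSm
        refine nsum_mono hS0 (show 4 * k ≤ m by omega) ?_
        rw [← nsum_nsum]
        exact nsmul_mem_nsum hs.1 k)
    obtain ⟨I, hI0, hI, hIn⟩ := filtration S2 n0 hn0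
    refine exists_ideal (NonUnitalSubring.closure Y) Z' hZ' hBZ' I n0 n
      (fun t ht => hI0 t (hY2 ht)) (fun t ht => hI t (hY2 ht)) hIn ?_
    intro v hvB hv
    choose c hc hc' using fun i => hTt (v i) (hT2T (hY2 (hvB i)))
    have := rank_bound K (n + 1) X hfin h0 hneg hadd S hSf hS0 hSneg
      ((nsum_mono hS0 (by omega)).trans hSm) (fun i => c i • v i) (indep_scale v hv c hc) hc'
    omega

/-- Structure theorem for finite approximate subrings, `(⌊4·log₂ K⌋`-nilpotent)-by-finite
version: `⟨Y⟩` has a two-sided ideal `J` of finite additive index which is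
`⌊4·log₂ K⌋`-nilpotent (in particular nilpotent of class at most `⌊4·log₂ K⌋`). -/
theorem stmt3 (K : ℕ) (hK : 1 ≤ K) :
    ∃ N : ℕ, ∀ (R : Type u) [NonUnitalRing R] (X : Set R),
      X.Finite → IsApproxSubringWith K X →
      ∃ Y : Set R,
        Y ⊆ (X + X + X + X) + X * (X + X + X + X) ∧ Y.Finite ∧
        IsApproxSubringWith (K ^ 510 + K ^ 22) Y ∧
        NCommensurable N Y X ∧
        ∃ J : Set R,
          IsTwoSidedIdealIn J (NonUnitalSubring.closure Y : Set R) ∧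
          (∃ F : Finset R, (NonUnitalSubring.closure Y : Set R) ⊆ (F : Set R) + J) ∧
          IsNNilpotentSet (Nat.floor ((4 : ℝ) * Real.logb 2 (K : ℝ))) J ∧
          mulIter J (Nat.floor ((4 : ℝ) * Real.logb 2 (K : ℝ))) ⊆ {0} := by
  obtain ⟨N, hN⟩ := main_aux.{u} K _ hK (two_pow_floor K hK)
  refine ⟨N, fun R _ X hfin hX => ?_⟩
  obtain ⟨Y, hY, h⟩ := hN R X hfin hX
  refine ⟨Y, fun y hy => ?_, h⟩
  have h0 : (0 : R) ∈ X := hX.1.1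
  obtain ⟨a, ha, b, hb, rfl⟩ := Set.mem_add.1 (hY hy)
  rw [nsum_one] at ha
  refine Set.mem_add.2 ⟨a + b, ?_, 0, ?_, by simp⟩
  · have h1 := Set.add_mem_add (Set.add_mem_add (Set.add_mem_add ha hb) h0) h0
    simpa using h1
  · refine Set.mem_mul.2 ⟨0, h0, 0, ?_, by simp⟩
    have h1 := Set.add_mem_add (Set.add_mem_add (Set.add_mem_add h0 h0) h0) h0
    simpa using h1
end

section
/- For every real number d > 0 there exists C = C(d) ∈ ℕ such that the following holds. Let S be a ring whose additive group is torsion-free, generated as a ring by a finite additively symmetric set X, and suppose that |X^{≤n}| ≤ n^d·|X| for infinitely many positive integers n. Then S has a two-sided ideal I whose additive index [S : I] is at most C and which is nilpotent of class at most ⌊4(57d+1)⌋. In particular, S is virtually nilpotent. -/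
open Pointwise

universe u

/-- `UsesAtMost X n x` holds if `x` can be obtained from elements of `X` using `+` and `*`
with at most `n` occurrences of elements of `X`, counting repetitions. -/
inductive UsesAtMost {R : Type u} [NonUnitalRing R] (X : Set R) : ℕ → R → Prop
  | mem {x : R} (hx : x ∈ X) : UsesAtMost X 1 x
  | weaken {n m : ℕ} {x : R} (h : UsesAtMost X n x) (hnm : n ≤ m) : UsesAtMost X m x
  | add {n m : ℕ} {x y : R} (hx : UsesAtMost X n x) (hy : UsesAtMost X m y) :
      UsesAtMost X (n + m) (x + y)
  | mul {n m : ℕ} {x y : R} (hx : UsesAtMost X n x) (hy : UsesAtMost X m y) :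
      UsesAtMost X (n + m) (x * y)

/-- `wordsLe X n` is `X^{≤n}`, the set of elements obtained from elements of `X` using `+`
and `*` with at most `n` occurrences of elements of `X`, counting repetitions. -/
def wordsLe {R : Type u} [NonUnitalRing R] (X : Set R) (n : ℕ) : Set R :=
  {x | UsesAtMost X n x}

theorem words_finite {R : Type u} [NonUnitalRing R] {X : Set R} (hX : X.Finite) (n : ℕ) :
    (wordsLe X n).Finite := by
  let B : ℕ → Set R := fun n => Nat.rec X (fun _ B => B ∪ ((B + B) ∪ (B * B))) n
  have hs : ∀ n, B (n + 1) = B n ∪ ((B n + B n) ∪ (B n * B n)) := fun _ => rfl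
  have hfin : ∀ n, (B n).Finite := by
    intro n
    induction n with
    | zero => exact hX
    | succ n ih => rw [hs]; exact ih.union ((ih.add ih).union (ih.mul ih))
  have hmono : Monotone B := monotone_nat_of_le_succ (fun n => by
    rw [hs]; exact Set.subset_union_left)
  have key : ∀ n x, UsesAtMost X n x → 1 ≤ n ∧ x ∈ B n := by
    intro n x h
    induction h with
    | mem hx => exact ⟨le_rfl, hmono (Nat.zero_le 1) hx⟩
    | weaken h hnm ih => exact ⟨ih.1.trans hnm, hmono hnm ih.2⟩
    | @add n m x y hx hy ihx ihy =>
      refine ⟨by omega, ?_⟩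
      have h1 : n ≤ n + m - 1 := by omega
      have h2 : m ≤ n + m - 1 := by omega
      have h3 : n + m = (n + m - 1) + 1 := by omega
      rw [h3, hs]
      exact Or.inr (Or.inl (Set.add_mem_add (hmono h1 ihx.2) (hmono h2 ihy.2)))
    | @mul n m x y hx hy ihx ihy =>
      refine ⟨by omega, ?_⟩
      have h1 : n ≤ n + m - 1 := by omega
      have h2 : m ≤ n + m - 1 := by omega
      have h3 : n + m = (n + m - 1) + 1 := by omega
      rw [h3, hs]
      exact Or.inr (Or.inr (Set.mul_mem_mul (hmono h1 ihx.2) (hmono h2 ihy.2)))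
  exact (hfin n).subset (fun x hx => (key n x hx).2)

theorem uses_nsmul {R : Type u} [NonUnitalRing R] {X : Set R} (h0 : (0 : R) ∈ X) {x : R}
    (hx : x ∈ X) {b : ℕ} (hb : 1 ≤ b) : ∀ a ≤ b, UsesAtMost X b (a • x) := by
  induction b, hb using Nat.le_induction with
  | base =>
    intro a ha
    interval_cases a
    · simpa using UsesAtMost.mem h0
    · simpa using UsesAtMost.mem hx
  | succ b hb ih =>
    intro a ha
    rcases Nat.lt_or_ge b a with h | h
    · obtain rfl : a = b + 1 := by omega
      rw [succ_nsmul]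
      exact (ih b le_rfl).add (UsesAtMost.mem hx)
    · exact (ih a h).weaken (by omega)

/-- multiples of a product of `k+1` generators have short expressions -/
theorem uses_prod {R : Type u} [NonUnitalRing R] {X : Set R} (h0 : (0 : R) ∈ X) (k : ℕ) :
    ∃ c : ℕ, 1 ≤ c ∧ ∀ p ∈ mulIter X k, UsesAtMost X c p ∧
      ∀ b : ℕ, 1 ≤ b → ∀ a < b ^ (k + 1), UsesAtMost X (c * b) (a • p) := by
  induction k with
  | zero =>
    refine ⟨1, le_rfl, fun p hp => ⟨UsesAtMost.mem hp, fun b hb a ha => ?_⟩⟩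
    rw [one_mul]
    exact uses_nsmul h0 hp hb a (by simpa using ha.le)
  | succ k ih =>
    obtain ⟨c, hc, ih⟩ := ih
    refine ⟨2 * c + 2, by omega, ?_⟩
    rintro p ⟨q, hq, x, hx, rfl⟩
    obtain ⟨hq1, hq2⟩ := ih q hq
    refine ⟨(hq1.mul (UsesAtMost.mem hx)).weaken (by omega), fun b hb a ha => ?_⟩
    have e : a • (q * x) = ((a / b) • q) * (b • x) + q * ((a % b) • x) := by
      conv_lhs => rw [← Nat.div_add_mod a b]
      rw [add_nsmul, smul_mul_smul_comm, mul_smul_comm, mul_comm b]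
    have hlt : a / b < b ^ (k + 1) := by
      rw [Nat.div_lt_iff_lt_mul hb, ← pow_succ]; exact ha
    show UsesAtMost X _ (a • (q * x))
    rw [e]
    refine (((hq2 b hb _ hlt).mul (uses_nsmul h0 hx hb b le_rfl)).add
      (hq1.mul (uses_nsmul h0 hx hb (a % b) (Nat.mod_lt _ hb).le))).weaken ?_
    nlinarith

theorem mulIter_mul {R : Type u} [NonUnitalRing R] (X : Set R) (i j : ℕ) :
    mulIter X i * mulIter X j = mulIter X (i + j + 1) := by
  induction j with
  | zero => rfl
  | succ j ih =>
    show mulIter X i * (mulIter X j * X) = mulIter X (i + j + 1) * X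
    rw [← ih, mul_assoc]

theorem mulIter_univ {R : Type u} [NonUnitalRing R] {X : Set R}
    (hgen : NonUnitalSubring.closure X = ⊤) (m : ℕ) (h : mulIter X m ⊆ {0}) :
    mulIter (Set.univ : Set R) m ⊆ {0} := by
  let T : ℕ → AddSubgroup R := fun k => AddSubgroup.closure (⋃ j ≥ k, mulIter X j)
  have hT : ∀ k j, k ≤ j → mulIter X j ⊆ T k := fun k j hkj x hx =>
    AddSubgroup.subset_closure (Set.mem_iUnion₂.2 ⟨j, hkj, hx⟩)
  have hmul : ∀ i j x y, x ∈ T i → y ∈ T j → x * y ∈ T (i + j + 1) := by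
    intro i j x y hx hy
    induction hx using AddSubgroup.closure_induction with
    | mem x hx =>
      induction hy using AddSubgroup.closure_induction with
      | mem y hy =>
        obtain ⟨i1, hi, hx⟩ := Set.mem_iUnion₂.1 hx
        obtain ⟨j1, hj, hy⟩ := Set.mem_iUnion₂.1 hy
        refine hT _ (i1 + j1 + 1) (by have : i ≤ i1 := hi; have : j ≤ j1 := hj; omega) ?_
        rw [← mulIter_mul]
        exact Set.mul_mem_mul hx hy
      | zero => simp
      | add a b _ _ ha hb => rw [mul_add]; exact add_mem ha hb
      | neg a _ ha => rw [mul_neg]; exact neg_mem ha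
    | zero => simp
    | add a b _ _ ha hb => rw [add_mul]; exact add_mem ha hb
    | neg a _ ha => rw [neg_mul]; exact neg_mem ha
  have hanti : ∀ k, T (k + 1) ≤ T k := fun k => (AddSubgroup.closure_le _).2 (by
    intro x hx
    obtain ⟨j, hj, hx⟩ := Set.mem_iUnion₂.1 hx
    exact hT k j (by have : k + 1 ≤ j := hj; omega) hx)
  have htop : ∀ x, x ∈ T 0 := by
    intro x
    have hx : x ∈ NonUnitalSubring.closure X := by rw [hgen]; trivial
    induction hx using NonUnitalSubring.closure_induction with
    | mem x hx => exact hT 0 0 le_rfl hx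
    | zero => exact zero_mem _
    | add a b _ _ ha hb => exact add_mem ha hb
    | neg a _ ha => exact neg_mem ha
    | mul a b _ _ ha hb => exact hanti 0 (hmul 0 0 a b ha hb)
  have huniv : ∀ k, mulIter (Set.univ : Set R) k ⊆ T k := by
    intro k
    induction k with
    | zero => exact fun x _ => htop x
    | succ k ih =>
      rintro _ ⟨q, hq, x, -, rfl⟩
      exact hmul k 0 q x (ih hq) (htop x)
  have hzero : ∀ j ≥ m, mulIter X j ⊆ {0} := by
    intro j hj
    induction j, hj using Nat.le_induction with
    | base => exact h
    | succ j hj ih =>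
      rintro _ ⟨q, hq, x, -, rfl⟩
      have : q = 0 := ih hq
      simp [this]
  intro x hx
  have hx := huniv m hx
  have : T m ≤ ⊥ := (AddSubgroup.closure_le _).2 (by
    intro x hx
    obtain ⟨j, hj, hx⟩ := Set.mem_iUnion₂.1 hx
    exact hzero j hj hx)
  exact this hx

/-- Ring-theoretic Gromov theorem (torsion-free case): for every `d > 0` there is `C = C(d)`
such that every torsion-free ring `S` generated by a finite additively symmetric set `X` with
`|X^{≤n}| ≤ n^d·|X|` for infinitely many positive integers `n` has a two-sided ideal `I` of
additive index at most `C` which is nilpotent of class at most `⌊4(57d+1)⌋`. -/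
theorem stmt6 (d : ℝ) (hd : 0 < d) :
    ∃ C : ℕ, ∀ (S : Type u) [NonUnitalRing S],
      (∀ (n : ℕ) (x : S), n ≠ 0 → n • x = 0 → x = 0) →
      ∀ X : Set S, X.Finite → AddSymm X → NonUnitalSubring.closure X = ⊤ →
      {n : ℕ | 0 < n ∧ ((wordsLe X n).ncard : ℝ) ≤ (n : ℝ) ^ d * (X.ncard : ℝ)}.Infinite →
      ∃ I : Set S, IsTwoSidedIdealIn I Set.univ ∧
        (∃ F : Finset S, F.card ≤ C ∧ Set.univ ⊆ (F : Set S) + I) ∧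
        mulIter I (Nat.floor ((4 : ℝ) * (57 * d + 1))) ⊆ {0} := by
  refine ⟨1, ?_⟩
  intro S _ htf X hX hsymm hgen hinf
  refine ⟨Set.univ, ⟨subset_rfl, trivial, fun _ _ _ _ => trivial, fun _ _ => trivial,
    fun _ _ _ _ => ⟨trivial, trivial⟩⟩, ⟨{0}, by simp, by simp⟩, ?_⟩
  set m := Nat.floor ((4 : ℝ) * (57 * d + 1)) with hm
  have hmd : d + 1 ≤ ((m + 1 : ℕ) : ℝ) := by
    have := Nat.lt_floor_add_one ((4 : ℝ) * (57 * d + 1))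
    rw [← hm] at this
    push_cast
    linarith
  refine mulIter_univ hgen m ?_
  intro p hp
  by_contra hp0
  have hp0 : p ≠ 0 := hp0
  obtain ⟨c, hc, hcp⟩ := uses_prod hsymm.1 m
  have hcp := (hcp p hp).2
  have hinj : Function.Injective (fun a : ℕ => a • p) := by
    have aux : ∀ a b : ℕ, a < b → a • p ≠ b • p := by
      intro a b hab h
      obtain ⟨e, rfl⟩ := Nat.exists_eq_add_of_lt hab
      rw [add_assoc, add_nsmul] at h
      exact hp0 (htf (e + 1) p (by omega) (by simpa using h.symm))
    intro a b h
    rcases lt_trichotomy a b with h1 | h1 | h1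
    · exact absurd h (aux a b h1)
    · exact h1
    · exact absurd h.symm (aux b a h1)
  have hlow : ∀ b n : ℕ, 1 ≤ b → c * b ≤ n → b ^ (m + 1) ≤ (wordsLe X n).ncard := by
    intro b n hb hn
    have hsub : Set.image (fun a : ℕ => a • p) (Finset.range (b ^ (m + 1)) : Set ℕ) ⊆
        wordsLe X n := by
      intro x hx
      simp only [Set.mem_image, Finset.coe_range, Set.mem_Iio] at hx
      obtain ⟨a, ha, rfl⟩ := hx
      exact (hcp b hb a ha).weaken hn
    have := Set.ncard_le_ncard hsub (words_finite hX n)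
    rwa [Set.ncard_image_of_injective _ hinj, Set.ncard_coe_finset,
      Finset.card_range] at this
  obtain ⟨N, hN⟩ := exists_nat_gt ((2 * c : ℝ) ^ d * X.ncard)
  refine hinf ((Set.finite_Iio (c * (N + 1))).subset ?_)
  rintro n ⟨hn0, hn⟩
  by_contra hlt
  have hge : c * (N + 1) ≤ n := by simpa using hlt
  set b := n / c with hb
  have hbN : N + 1 ≤ b := by
    rw [hb, Nat.le_div_iff_mul_le hc, mul_comm]; exact hge
  have h1 := hlow b n (by omega) (Nat.mul_div_le n c)
  have hn2 : n ≤ 2 * c * b := by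
    have h2 := Nat.div_add_mod n c
    have h3 := Nat.mod_lt n hc
    rw [← hb] at h2
    nlinarith
  have hb1 : (1 : ℝ) ≤ b := by exact_mod_cast (by omega : 1 ≤ b)
  have hbpos : (0 : ℝ) < b := by linarith
  have h3 : (b : ℝ) ^ (d + 1) ≤ (b : ℝ) ^ d * ((2 * c : ℝ) ^ d * X.ncard) := by
    calc (b : ℝ) ^ (d + 1) ≤ (b : ℝ) ^ (((m + 1 : ℕ) : ℝ)) :=
          Real.rpow_le_rpow_of_exponent_le hb1 hmd
      _ = ((b ^ (m + 1) : ℕ) : ℝ) := by rw [Real.rpow_natCast]; push_cast; rfl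
      _ ≤ (wordsLe X n).ncard := by exact_mod_cast h1
      _ ≤ (n : ℝ) ^ d * X.ncard := hn
      _ ≤ ((2 * c : ℝ) * b) ^ d * X.ncard := by
          gcongr
          exact_mod_cast hn2
      _ = _ := by rw [Real.mul_rpow (by positivity) (by positivity)]; ring
  rw [Real.rpow_add hbpos, Real.rpow_one] at h3
  have h4 := le_of_mul_le_mul_left h3 (Real.rpow_pos_of_pos hbpos d)
  have h5 : ((N + 1 : ℕ) : ℝ) ≤ b := by exact_mod_cast hbN
  push_cast at h5
  linarith
end

section
/- Let S be a ring generated as a ring by a finite additively symmetric set X, and suppose S has a two-sided ideal I of finite additive index in S which is nilpotent (of class at most c for some c ∈ ℕ). Then S has polynomial growth: there exist d ∈ ℕ and a constant C > 0 such that |X^{≤n}| ≤ C·n^d for all positive integers n. -/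
open Pointwise

universe u

section Helpers

open Polynomial

variable {R : Type u} [NonUnitalRing R]

/-- `PolyRep T p x`: `x` is a sum of at most `p.coeff k` products of `k` elements of `T`, over `k`. -/
inductive PolyRep (T : Set R) : ℕ[X] → R → Prop
  | zero : PolyRep T 0 0
  | mono {k : ℕ} {t : R} (ht : t ∈ mulIter T k) : PolyRep T (X ^ (k + 1)) t
  | add {p q : ℕ[X]} {x y : R} (hx : PolyRep T p x) (hy : PolyRep T q y) : PolyRep T (p + q) (x + y)
  | weaken {p : ℕ[X]} (q : ℕ[X]) {x : R} (hx : PolyRep T p x) : PolyRep T (p + q) x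

theorem mulIter_mul_s7 {T : Set R} {a b : ℕ} {x y : R} (hx : x ∈ mulIter T a)
    (hy : y ∈ mulIter T b) : x * y ∈ mulIter T (a + b + 1) := by
  induction b generalizing y with
  | zero => exact Set.mul_mem_mul hx hy
  | succ b ih =>
    obtain ⟨u, hu, v, hv, rfl⟩ := hy
    have := ih hu
    show x * (u * v) ∈ _
    rw [← mul_assoc]
    exact Set.mul_mem_mul this hv

theorem mulIter_mono {T U : Set R} (h : T ⊆ U) (k : ℕ) : mulIter T k ⊆ mulIter U k := by
  induction k with
  | zero => exact h
  | succ k ih => exact Set.mul_subset_mul ih h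

theorem mulIter_finite {T : Set R} (h : T.Finite) (k : ℕ) : (mulIter T k).Finite := by
  induction k with
  | zero => exact h
  | succ k ih => exact ih.mul h

theorem mulIter_vanish {T : Set R} {c k : ℕ} (h : mulIter T c ⊆ {0}) (hk : c ≤ k) :
    mulIter T k ⊆ {0} := by
  induction k, hk using Nat.le_induction with
  | base => exact h
  | succ k hk ih =>
    rintro _ ⟨u, hu, v, hv, rfl⟩
    have : u = 0 := ih hu
    simp [this]

theorem PolyRep.cast {T : Set R} {p q : ℕ[X]} {x y : R} (h : PolyRep T p x) (hp : p = q) (hx : x = y) :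
    PolyRep T q y := by subst hp hx; exact h

theorem PolyRep.mul {T : Set R} {p q : ℕ[X]} {x y : R} (hx : PolyRep T p x) (hy : PolyRep T q y) :
    PolyRep T (p * q) (x * y) := by
  induction hx with
  | zero => exact PolyRep.zero.cast (by simp) (by simp)
  | add _ _ h1 h2 => exact (h1.add h2).cast (by ring) (by rw [add_mul])
  | weaken r _ h1 => exact (h1.weaken (r * q)).cast (by ring) rfl
  | @mono k t ht =>
    induction hy with
    | zero => exact PolyRep.zero.cast (by simp) (by simp)
    | add _ _ h1 h2 => exact (h1.add h2).cast (by ring) (by rw [mul_add])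
    | weaken r _ h1 => exact (h1.weaken (X ^ (k + 1) * r)).cast (by ring) rfl
    | @mono l s hs => exact (PolyRep.mono (mulIter_mul_s7 ht hs)).cast (by ring) rfl

theorem PolyRep.left {T F : Set R} (hFT : ∀ f ∈ F, ∀ t ∈ T, ∃ u ∈ T, ∃ v ∈ T * T, f * t = u + v)
    {f : R} (hf : f ∈ F) {p : ℕ[X]} {x : R} (hx : PolyRep T p x) : PolyRep T ((1 + X) * p) (f * x) := by
  induction hx with
  | zero => exact PolyRep.zero.cast (by simp) (by simp)
  | add _ _ h1 h2 => exact (h1.add h2).cast (by ring) (by rw [mul_add])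
  | weaken r _ h1 => exact (h1.weaken ((1 + X) * r)).cast (by ring) rfl
  | @mono k t ht =>
    have key : ∃ u ∈ mulIter T k, ∃ v ∈ mulIter T (k + 1), f * t = u + v := by
      clear * - hf ht hFT
      induction k generalizing t with
      | zero => exact hFT f hf t ht
      | succ k ih =>
        obtain ⟨a, ha, b, hb, rfl⟩ := ht
        obtain ⟨u, hu, v, hv, h⟩ := ih ha
        refine ⟨u * b, Set.mul_mem_mul hu hb, v * b, Set.mul_mem_mul hv hb, ?_⟩
        show f * (a * b) = _
        rw [← mul_assoc, h, add_mul]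
    obtain ⟨u, hu, v, hv, h⟩ := key
    exact ((PolyRep.mono hu).add (PolyRep.mono hv)).cast (by ring) h.symm

theorem PolyRep.right {T F : Set R} (hTF : ∀ f ∈ F, ∀ t ∈ T, ∃ u ∈ T, ∃ v ∈ T * T, t * f = u + v)
    {f : R} (hf : f ∈ F) {p : ℕ[X]} {x : R} (hx : PolyRep T p x) : PolyRep T ((1 + X) * p) (x * f) := by
  induction hx with
  | zero => exact PolyRep.zero.cast (by simp) (by simp)
  | add _ _ h1 h2 => exact (h1.add h2).cast (by ring) (by rw [add_mul])
  | weaken r _ h1 => exact (h1.weaken ((1 + X) * r)).cast (by ring) rfl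
  | @mono k t ht =>
    have key : ∃ u ∈ mulIter T k, ∃ v ∈ mulIter T (k + 1), t * f = u + v := by
      cases k with
      | zero => exact hTF f hf t ht
      | succ k =>
        obtain ⟨a, ha, b, hb, rfl⟩ := ht
        obtain ⟨u, hu, v, hv, h⟩ := hTF f hf b hb
        refine ⟨a * u, Set.mul_mem_mul ha hu, a * v, mulIter_mul_s7 (b := 1) ha hv, ?_⟩
        show a * b * f = _
        rw [mul_assoc, h, mul_add]
    obtain ⟨u, hu, v, hv, h⟩ := key
    exact ((PolyRep.mono hu).add (PolyRep.mono hv)).cast (by ring) h.symm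

theorem one_add_pow_exists (j : ℕ) : ∃ r : ℕ[X], (1 + X) ^ j = 1 + r := by
  induction j with
  | zero => exact ⟨0, by simp⟩
  | succ j ih =>
    obtain ⟨r, hr⟩ := ih
    exact ⟨r + X + r * X, by rw [pow_succ, hr]; ring⟩

theorem usesAtMost_rep {Y F T : Set R} (hYF : Y ⊆ F)
    (hadd : ∀ f ∈ F, ∀ g ∈ F, ∃ h ∈ F, ∃ t ∈ T, f + g = h + t)
    (hmul : ∀ f ∈ F, ∀ g ∈ F, ∃ h ∈ F, ∃ t ∈ T, f * g = h + t)
    (hFT : ∀ f ∈ F, ∀ t ∈ T, ∃ u ∈ T, ∃ v ∈ T * T, f * t = u + v)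
    (hTF : ∀ f ∈ F, ∀ t ∈ T, ∃ u ∈ T, ∃ v ∈ T * T, t * f = u + v)
    {n : ℕ} {x : R} (hx : UsesAtMost Y n x) :
    ∃ f ∈ F, ∃ y, ∃ p : ℕ[X], x = f + y ∧ PolyRep T p y ∧ (1 + X) * (1 + p) = (1 + X) ^ (2 * n) := by
  induction hx with
  | @mem x hx =>
    exact ⟨x, hYF hx, 0, X, by simp, (PolyRep.zero.weaken X).cast (by simp) rfl, by ring⟩
  | @weaken n m x _ hnm ih =>
    obtain ⟨f, hf, y, p, rfl, hy, hp⟩ := ih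
    obtain ⟨r, hr⟩ := one_add_pow_exists (2 * (m - n))
    refine ⟨f, hf, y, p + (r + p * r), rfl, hy.weaken _, ?_⟩
    have : 2 * m = 2 * n + 2 * (m - n) := by omega
    rw [this, pow_add, ← hp, hr]
    ring
  | @add n m x y _ _ ih1 ih2 =>
    obtain ⟨f, hf, y, p, rfl, hy, hp⟩ := ih1
    obtain ⟨g, hg, z, q, rfl, hz, hq⟩ := ih2
    obtain ⟨h, hh, t, ht, e⟩ := hadd f hf g hg
    have ht' : PolyRep T X t := (PolyRep.mono (k := 0) ht).cast (by simp) rfl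
    refine ⟨h, hh, t + y + z, X + p + q + (X * p + X * q + (1 + X) * p * q), ?_,
      ((ht'.add hy).add hz).weaken _, ?_⟩
    · rw [add_add_add_comm, e]; abel
    · rw [mul_add 2, pow_add, ← hp, ← hq]; ring
  | @mul n m x y _ _ ih1 ih2 =>
    obtain ⟨f, hf, y, p, rfl, hy, hp⟩ := ih1
    obtain ⟨g, hg, z, q, rfl, hz, hq⟩ := ih2
    obtain ⟨h, hh, t, ht, e⟩ := hmul f hf g hg
    have ht' : PolyRep T X t := (PolyRep.mono (k := 0) ht).cast (by simp) rfl
    refine ⟨h, hh, t + f * z + y * g + y * z,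
      X + (1 + X) * q + (1 + X) * p + p * q + X * p * q, ?_,
      (((ht'.add (hz.left hFT hf)).add (hy.right hTF hg)).add (hy.mul hz)).weaken _, ?_⟩
    · rw [add_mul, mul_add, mul_add, e]; abel
    · rw [mul_add 2, pow_add, ← hp, ← hq]; ring

theorem PolyRep.count {T : Set R} {c : ℕ} (hT : mulIter T c ⊆ {0}) (U : Finset R)
    (hU : ∀ k < c, mulIter T k ⊆ U) {p : ℕ[X]} {x : R} (hx : PolyRep T p x) :
    ∃ a : R → ℕ, x = ∑ t ∈ U, a t • t ∧ ∀ t, a t ≤ ∑ k ∈ Finset.range (c + 1), p.coeff k := by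
  classical
  induction hx with
  | zero => exact ⟨fun _ => 0, by simp, by simp⟩
  | add _ _ h1 h2 =>
    obtain ⟨a, rfl, ha⟩ := h1
    obtain ⟨b, rfl, hb⟩ := h2
    refine ⟨fun t => a t + b t, by simp [add_smul, Finset.sum_add_distrib], fun t => ?_⟩
    simp only [coeff_add, Finset.sum_add_distrib]
    exact add_le_add (ha t) (hb t)
  | weaken r _ h1 =>
    obtain ⟨a, rfl, ha⟩ := h1
    refine ⟨a, rfl, fun t => ?_⟩
    simp only [coeff_add, Finset.sum_add_distrib]
    exact (ha t).trans (Nat.le_add_right _ _)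
  | @mono k t ht =>
    by_cases hk : k < c
    · refine ⟨fun s => if s = t then 1 else 0, ?_, fun s => ?_⟩
      · have := hU k hk ht
        simp only [ite_smul, one_smul, zero_smul, Finset.sum_ite_eq']
        rw [if_pos (by simpa using this)]
      · have : ∑ j ∈ Finset.range (c + 1), (X ^ (k + 1) : ℕ[X]).coeff j = 1 := by
          simp [coeff_X_pow, hk]
        rw [this]
        dsimp only
        split_ifs <;> simp
    · have : t = 0 := mulIter_vanish hT (not_lt.mp hk) ht
      exact ⟨fun _ => 0, by simp [this], by simp⟩

theorem coeff_sum_bound {c n : ℕ} (hn : 0 < n) {p : ℕ[X]}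
    (hp : (1 + X) * (1 + p) = (1 + X) ^ (2 * n)) :
    ∑ k ∈ Finset.range (c + 1), p.coeff k ≤ (c + 1) * (2 * n) ^ c := by
  have h1 : ∀ k ∈ Finset.range (c + 1), p.coeff k ≤ (2 * n) ^ c := by
    intro k hk
    have h2 : p.coeff k ≤ ((1 + X : ℕ[X]) ^ (2 * n)).coeff k := by
      rw [← hp, show (1 + X) * (1 + p) = p + (1 + X + X * p) by ring, coeff_add]
      exact Nat.le_add_right _ _
    rw [coeff_one_add_X_pow] at h2
    refine h2.trans ?_
    refine (Nat.cast_id _).le.trans ((Nat.choose_le_pow _ _).trans ?_)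
    exact Nat.pow_le_pow_right (by omega) (by simpa [Nat.lt_succ_iff] using hk)
  simpa using Finset.sum_le_card_nsmul _ _ _ h1

theorem exists_sets (Y : Set R) (hfin : Y.Finite) (I : Set R)
    (hI : IsTwoSidedIdealIn I Set.univ)
    (hindex : ∃ F : Finset R, Set.univ ⊆ (F : Set R) + I) :
    ∃ F T : Set R, F.Finite ∧ T.Finite ∧ Y ⊆ F ∧ T ⊆ I ∧
    (∀ f ∈ F, ∀ g ∈ F, ∃ h ∈ F, ∃ t ∈ T, f + g = h + t) ∧
    (∀ f ∈ F, ∀ g ∈ F, ∃ h ∈ F, ∃ t ∈ T, f * g = h + t) ∧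
    (∀ f ∈ F, ∀ t ∈ T, ∃ u ∈ T, ∃ v ∈ T * T, f * t = u + v) ∧
    (∀ f ∈ F, ∀ t ∈ T, ∃ u ∈ T, ∃ v ∈ T * T, t * f = u + v) := by
  obtain ⟨F0, hF0⟩ := hindex
  obtain ⟨-, h0, -, -, hid⟩ := hI
  have hl : ∀ r, ∀ x ∈ I, r * x ∈ I := fun r x hx => (hid r (Set.mem_univ _) x hx).1
  have hr : ∀ r, ∀ x ∈ I, x * r ∈ I := fun r x hx => (hid r (Set.mem_univ _) x hx).2
  have hdec : ∀ s : R, ∃ f ∈ F0, ∃ i ∈ I, f + i = s := fun s => by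
    simpa [Set.mem_add] using hF0 (Set.mem_univ s)
  choose φ hφ ι hι hs using hdec
  let F : Set R := ↑F0 ∪ Y
  have hF : F.Finite := F0.finite_toSet.union hfin
  have hφF : ∀ s, φ s ∈ F := fun s => Or.inl (hφ s)
  let J : Set R := {0} ∪ (Set.image ι (F + F) ∪ Set.image ι (F * F))
  have hJ : J.Finite := (Set.finite_singleton 0).union
    (((hF.add hF).image _).union ((hF.mul hF).image _))
  have hJI : J ⊆ I := by
    rintro x (hx | ⟨s, -, rfl⟩ | ⟨s, -, rfl⟩)
    · rw [Set.mem_singleton_iff.mp hx]; exact h0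
    · exact hι s
    · exact hι s
  have hJm : ∀ f ∈ F, ∀ g ∈ F, ι (f * g) ∈ J := fun f hf g hg =>
    Or.inr (Or.inr ⟨_, Set.mul_mem_mul hf hg, rfl⟩)
  let T : Set R := J ∪ (F * J ∪ (J * F ∪ F * J * F))
  have hJT : J ⊆ T := fun x hx => Or.inl hx
  have t1 : ∀ f ∈ F, ∀ j ∈ J, f * j ∈ T := fun f hf j hj =>
    Or.inr (Or.inl (Set.mul_mem_mul hf hj))
  have t2 : ∀ f ∈ F, ∀ j ∈ J, j * f ∈ T := fun f hf j hj =>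
    Or.inr (Or.inr (Or.inl (Set.mul_mem_mul hj hf)))
  have t3 : ∀ f ∈ F, ∀ j ∈ J, ∀ g ∈ F, f * j * g ∈ T := fun f hf j hj g hg =>
    Or.inr (Or.inr (Or.inr (Set.mul_mem_mul (Set.mul_mem_mul hf hj) hg)))
  have z : (0 : R) ∈ T := hJT (Or.inl rfl)
  have zz : (0 : R) ∈ T * T := ⟨0, z, 0, z, by simp⟩
  refine ⟨F, T, hF, ?_, fun x hx => Or.inr hx, ?_, ?_, ?_, ?_, ?_⟩
  · exact hJ.union ((hF.mul hJ).union ((hJ.mul hF).union ((hF.mul hJ).mul hF)))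
  · rintro x (hx | ⟨f, -, j, hj, rfl⟩ | ⟨j, hj, f, -, rfl⟩ | ⟨_, ⟨f, -, j, hj, rfl⟩, g, -, rfl⟩)
    · exact hJI hx
    · exact hl _ _ (hJI hj)
    · exact hr _ _ (hJI hj)
    · exact hr _ _ (hl _ _ (hJI hj))
  · intro f hf g hg
    exact ⟨_, hφF (f + g), _, hJT (Or.inr (Or.inl ⟨_, Set.add_mem_add hf hg, rfl⟩)), (hs _).symm⟩
  · intro f hf g hg
    exact ⟨_, hφF (f * g), _, hJT (hJm f hf g hg), (hs _).symm⟩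
  · rintro f hf _ (hx | ⟨g, hg, j, hj, rfl⟩ | ⟨j, hj, g, hg, rfl⟩ |
      ⟨_, ⟨g, hg, j, hj, rfl⟩, k, hk, rfl⟩)
    · exact ⟨_, t1 f hf _ hx, 0, zz, by simp⟩
    · refine ⟨_, t1 _ (hφF (f * g)) j hj, _,
        Set.mul_mem_mul (hJT (hJm f hf g hg)) (hJT hj), ?_⟩
      rw [← add_mul, hs, mul_assoc]
    · exact ⟨_, t3 f hf j hj g hg, 0, zz, by simp [mul_assoc]⟩
    · refine ⟨_, t3 _ (hφF (f * g)) j hj k hk, _,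
        Set.mul_mem_mul (hJT (hJm f hf g hg)) (t2 k hk j hj), ?_⟩
      rw [mul_assoc (φ _), ← add_mul, hs]
      simp only [mul_assoc]
  · rintro f hf _ (hx | ⟨g, hg, j, hj, rfl⟩ | ⟨j, hj, g, hg, rfl⟩ |
      ⟨_, ⟨g, hg, j, hj, rfl⟩, k, hk, rfl⟩)
    · exact ⟨_, t2 f hf _ hx, 0, zz, by simp⟩
    · exact ⟨_, t3 g hg j hj f hf, 0, zz, by simp⟩
    · refine ⟨_, t2 _ (hφF (g * f)) j hj, _,
        Set.mul_mem_mul (hJT hj) (hJT (hJm g hg f hf)), ?_⟩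
      rw [← mul_add, hs, mul_assoc]
    · refine ⟨_, t3 g hg j hj _ (hφF (k * f)), _,
        Set.mul_mem_mul (t1 g hg j hj) (hJT (hJm k hk f hf)), ?_⟩
      rw [← mul_add, hs]
      simp only [mul_assoc]

end Helpers

/-- A finitely generated virtually nilpotent ring has polynomial growth: if `S` is generated
by a finite additively symmetric set `X` and has a nilpotent two-sided ideal `I` of finite
additive index, then there are `d ∈ ℕ` and `C > 0` with `|X^{≤n}| ≤ C·n^d` for all `n ≥ 1`. -/
theorem stmt7 {S : Type u} [NonUnitalRing S] (X : Set S) (hfin : X.Finite)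
    (hsym : AddSymm X) (hgen : NonUnitalSubring.closure X = ⊤)
    (I : Set S) (hI : IsTwoSidedIdealIn I Set.univ)
    (hindex : ∃ F : Finset S, Set.univ ⊆ (F : Set S) + I)
    (c : ℕ) (hnil : mulIter I c ⊆ {0}) :
    ∃ (d : ℕ) (C : ℝ), 0 < C ∧
      ∀ n : ℕ, 0 < n → ((wordsLe X n).ncard : ℝ) ≤ C * (n : ℝ) ^ d := by
  classical
  obtain ⟨F, T, hF, hT, hXF, hTI, h1, h2, h3, h4⟩ := exists_sets X hfin I hI hindex
  have hTc : mulIter T c ⊆ {0} := (mulIter_mono hTI c).trans hnil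
  have hUfin : (⋃ k ∈ Finset.range c, mulIter T k).Finite :=
    Set.Finite.biUnion (Finset.finite_toSet _) (fun k _ => mulIter_finite hT k)
  let U : Finset S := hUfin.toFinset
  have hU : ∀ k < c, mulIter T k ⊆ U := by
    intro k hk x hx
    simp only [U, Set.Finite.coe_toFinset, Set.mem_iUnion]
    exact ⟨k, Finset.mem_range.mpr hk, hx⟩
  let A : ℕ := (c + 1) * 2 ^ c + 1
  refine ⟨c * U.card, (hF.toFinset.card : ℝ) * (A : ℝ) ^ U.card + 1, by positivity, ?_⟩
  intro n hn
  let N : ℕ := (c + 1) * (2 * n) ^ c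
  let D : Finset (S × ((t : S) → t ∈ U → ℕ)) :=
    hF.toFinset ×ˢ U.pi (fun _ => Finset.range (N + 1))
  let ψ : S × ((t : S) → t ∈ U → ℕ) → S := fun q => q.1 + ∑ t ∈ U.attach, q.2 t.1 t.2 • t.1
  have hsub : wordsLe X n ⊆ (D.image ψ : Finset S) := by
    intro x hx
    obtain ⟨f, hf, y, p, rfl, hy, hp⟩ := usesAtMost_rep hXF h1 h2 h3 h4 hx
    obtain ⟨a, rfl, ha⟩ := hy.count hTc U hU
    simp only [Finset.coe_image, Set.mem_image, Finset.mem_coe]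
    refine ⟨(f, fun t _ => a t), ?_, ?_⟩
    · simp only [D, Finset.mem_product, Finset.mem_pi, Finset.mem_range, Set.Finite.mem_toFinset]
      exact ⟨hf, fun t _ => Nat.lt_succ_of_le ((ha t).trans (coeff_sum_bound hn hp))⟩
    · simp only [ψ]
      rw [Finset.sum_attach U (fun t => a t • t)]
  have hcard : (wordsLe X n).ncard ≤ hF.toFinset.card * (N + 1) ^ U.card := by
    calc (wordsLe X n).ncard ≤ ((D.image ψ : Finset S) : Set S).ncard :=
          Set.ncard_le_ncard hsub (Finset.finite_toSet _)
      _ = (D.image ψ).card := Set.ncard_coe_finset _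
      _ ≤ D.card := Finset.card_image_le
      _ = _ := by simp [D, Finset.card_product, Finset.card_pi]
  have hN : N + 1 ≤ A * n ^ c := by
    have : 1 ≤ n ^ c := Nat.one_le_pow _ _ hn
    simp only [N, A, mul_pow, add_mul, one_mul]
    nlinarith
  have hfinal : (wordsLe X n).ncard ≤ (hF.toFinset.card * A ^ U.card + 1) * n ^ (c * U.card) := by
    calc _ ≤ _ := hcard
      _ ≤ hF.toFinset.card * (A * n ^ c) ^ U.card := by gcongr
      _ = (hF.toFinset.card * A ^ U.card) * n ^ (c * U.card) := by
          rw [mul_pow, ← pow_mul, mul_assoc]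
      _ ≤ _ := Nat.mul_le_mul_right _ (Nat.le_succ _)
  exact_mod_cast hfinal
end

section
/- Let F be a field and X ⊆ F an infinite approximate subring of F such that for every positive integer n the set Alg_n(X) is contained in a union of finitely many additive translates of X. Then 4X + X·4X is a subfield of F. -/
open Pointwise

universe u

/-- `X` is an approximate subring: it is additively symmetric and `X·X ∪ (X+X)` is covered by
finitely many additive translates of `X`. -/
def IsApproxSubring {R : Type u} [NonUnitalRing R] (X : Set R) : Prop :=
  AddSymm X ∧ ∃ F : Set R, F.Finite ∧ (X * X) ∪ (X + X) ⊆ F + X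

/-- `prodsLe X n` is the set of products of at most `n` (and at least one) elements of `X`. -/
def prodsLe {F : Type u} [Field F] (X : Set F) : ℕ → Set F
  | 0 => ∅
  | 1 => X
  | n + 2 => prodsLe X (n + 1) ∪ prodsLe X (n + 1) * X

/-- `sumsLe A n` is the set of sums of at most `n` (and at least one) elements of `A`. -/
def sumsLe {F : Type u} [Field F] (A : Set F) : ℕ → Set F
  | 0 => ∅
  | 1 => A
  | n + 2 => sumsLe A (n + 1) ∪ (sumsLe A (n + 1) + A)

/-- `algN X n` is `Alg_n(X)`: the set of quotients `a·b⁻¹` (`b ≠ 0`) where `a` and `b` are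
sums of at most `n` terms, each term a product of at most `n` elements of `X`. -/
def algN {F : Type u} [Field F] (X : Set F) (n : ℕ) : Set F :=
  {x | ∃ a ∈ sumsLe (prodsLe X n) n, ∃ b ∈ sumsLe (prodsLe X n) n, b ≠ 0 ∧ x = a * b⁻¹}

/-- `c` such that `c • X` is covered by finitely many translates of `X`. -/
def Comm9 {F : Type u} [Field F] (X : Set F) (c : F) : Prop :=
  ∃ E : Set F, E.Finite ∧ ∀ x ∈ X, ∃ e ∈ E, c * x - e ∈ X

theorem pigeon9 {F : Type u} [Field F] (X : Set F) (hinf : X.Infinite)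
    (hneg : ∀ x ∈ X, -x ∈ X) (G : Set F) (hG : G.Finite) (hGc : ∀ g ∈ G, Comm9 X g) :
    ∃ x ∈ X, ∃ y ∈ X, x + y ≠ 0 ∧ ∀ g ∈ G, ∃ a ∈ X, ∃ b ∈ X, (x + y) * g = a + b := by
  have := hG.to_subtype
  choose E hE hcov using fun g : G => hGc g g.2
  choose φ hφ hφ' using hcov
  classical
  let f : F → (G → F) := fun x g => if hx : x ∈ X then φ g x hx else 0
  have hfin : {u : G → F | ∀ g, u g ∈ E g}.Finite := Set.Finite.pi' hE
  have hmaps : Set.MapsTo f X {u : G → F | ∀ g, u g ∈ E g} := by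
    intro x hx g
    simp only [f, dif_pos hx]
    exact hφ g x hx
  obtain ⟨x, hx, y, hy, hne, heq⟩ := hinf.exists_ne_map_eq_of_mapsTo hmaps hfin
  refine ⟨x, hx, -y, hneg y hy, fun h => hne (by linear_combination h), fun g hg => ?_⟩
  have h := congrFun heq ⟨g, hg⟩
  simp only [f, dif_pos hx, dif_pos hy] at h
  refine ⟨_, hφ' ⟨g, hg⟩ x hx, _, hneg _ (hφ' ⟨g, hg⟩ y hy), ?_⟩
  rw [h]
  ring

theorem quot9 {F : Type u} [Field F] (X : Set F) (hinf : X.Infinite)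
    (hneg : ∀ x ∈ X, -x ∈ X) (c : F) (hc : Comm9 X c) :
    ∃ x ∈ X, ∃ y ∈ X, ∃ a ∈ X, ∃ b ∈ X, x + y ≠ 0 ∧ c = (a + b) * (x + y)⁻¹ := by
  obtain ⟨x, hx, y, hy, hne, h⟩ := pigeon9 X hinf hneg {c} (Set.finite_singleton c)
    (by rintro _ rfl; exact hc)
  obtain ⟨a, ha, b, hb, hab⟩ := h c rfl
  refine ⟨x, hx, y, hy, a, ha, b, hb, hne, ?_⟩
  rw [← hab]
  field_simp

theorem sums9 {F : Type u} [Field F] (X : Set F) (a b : F) (ha : a ∈ prodsLe X 2)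
    (hb : b ∈ prodsLe X 2) : a + b ∈ sumsLe (prodsLe X 2) 2 :=
  Or.inr (Set.add_mem_add ha hb)

/-- If `X` is an infinite approximate subring of a field such that each `Alg_n(X)` is covered
by finitely many additive translates of `X`, then `4X + X·4X` is a subfield. -/
theorem stmt9 {F : Type u} [Field F] (X : Set F) (hinf : X.Infinite)
    (happrox : IsApproxSubring X)
    (halg : ∀ n : ℕ, 1 ≤ n → ∃ E : Set F, E.Finite ∧ algN X n ⊆ E + X) :
    ∃ K : Subfield F, (K : Set F) = (X + X + X + X) + X * (X + X + X + X) := by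
  obtain ⟨⟨h0, hsymm⟩, D, hD, hXD⟩ := happrox
  have hneg : ∀ x ∈ X, -x ∈ X := fun x hx => by
    rw [hsymm]; simpa using hx
  have hmulc : ∀ x ∈ X, ∀ y ∈ X, ∃ d ∈ D, x * y - d ∈ X := fun x hx y hy => by
    obtain ⟨d, hd, z, hz, h⟩ := hXD (Or.inl (Set.mul_mem_mul hx hy))
    exact ⟨d, hd, by simpa [← h] using hz⟩
  have haddc : ∀ x ∈ X, ∀ y ∈ X, ∃ d ∈ D, x + y - d ∈ X := fun x hx y hy => by
    obtain ⟨d, hd, z, hz, h⟩ := hXD (Or.inr (Set.add_mem_add hx hy))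
    exact ⟨d, hd, by simpa [← h] using hz⟩
  obtain ⟨E, hE, hAE⟩ := halg 2 (by norm_num)
  have hp1 : ∀ x ∈ X, x ∈ prodsLe X 2 := fun x hx => Or.inl hx
  have hp2 : ∀ x ∈ X, ∀ y ∈ X, x * y ∈ prodsLe X 2 :=
    fun x hx y hy => Or.inr (Set.mul_mem_mul hx hy)
  have hmemX : ∀ x ∈ X, Comm9 X x := fun x hx => ⟨D, hD, fun y hy => hmulc x hx y hy⟩
  let K : Subfield F :=
    { carrier := {c | Comm9 X c}
      mul_mem' := by
        rintro a b ⟨A, hA, ha⟩ ⟨B, hB, hb⟩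
        refine ⟨Set.image (fun z => a * z) B + A, (hB.image _).add hA, fun x hx => ?_⟩
        obtain ⟨e, he, h1⟩ := hb x hx
        obtain ⟨e', he', h2⟩ := ha _ h1
        refine ⟨a * e + e', Set.add_mem_add ⟨e, he, rfl⟩ he', ?_⟩
        convert h2 using 1
        ring
      one_mem' := ⟨{0}, Set.finite_singleton 0, fun x hx => ⟨0, rfl, by simpa using hx⟩⟩
      add_mem' := by
        rintro a b ⟨A, hA, ha⟩ ⟨B, hB, hb⟩
        refine ⟨A + B + D, (hA.add hB).add hD, fun x hx => ?_⟩
        obtain ⟨e, he, h1⟩ := ha x hx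
        obtain ⟨e', he', h2⟩ := hb x hx
        obtain ⟨d, hd, h3⟩ := haddc _ h1 _ h2
        refine ⟨e + e' + d, Set.add_mem_add (Set.add_mem_add he he') hd, ?_⟩
        convert h3 using 1
        ring
      zero_mem' := ⟨{0}, Set.finite_singleton 0, fun x hx => ⟨0, rfl, by simpa using h0⟩⟩
      neg_mem' := by
        rintro a ⟨A, hA, ha⟩
        refine ⟨A, hA, fun x hx => ?_⟩
        obtain ⟨e, he, h1⟩ := ha _ (hneg x hx)
        refine ⟨e, he, ?_⟩
        convert h1 using 1
        ring
      inv_mem' := by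
        intro c hc
        obtain ⟨x, hx, y, hy, a, ha, b, hb, hne, rfl⟩ := quot9 X hinf hneg c hc
        by_cases hab : a + b = 0
        · rw [hab] at hc ⊢
          simpa using hc
        refine ⟨E, hE, fun z hz => ?_⟩
        have : (x * z + y * z) * (a + b)⁻¹ ∈ algN X 2 :=
          ⟨_, sums9 X _ _ (hp2 x hx z hz) (hp2 y hy z hz), _,
            sums9 X _ _ (hp1 a ha) (hp1 b hb), hab, rfl⟩
        obtain ⟨e, he, w, hw, h⟩ := hAE this
        refine ⟨e, he, ?_⟩
        convert hw using 1
        have h' : e + w = (x * z + y * z) * (a + b)⁻¹ := h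
        rw [mul_inv, inv_inv]
        linear_combination -h' }
  have hXK : ∀ x ∈ X, x ∈ K := hmemX
  refine ⟨K, Set.Subset.antisymm ?_ ?_⟩
  · intro c hc
    obtain ⟨x, hx, y, hy, hne, ht⟩ := pigeon9 X hinf hneg (E ∩ {c | Comm9 X c})
      (hE.subset Set.inter_subset_left) (fun g hg => hg.2)
    have hq : c * (x + y)⁻¹ ∈ K :=
      K.mul_mem hc (K.inv_mem (K.add_mem (hXK x hx) (hXK y hy)))
    obtain ⟨x', hx', y', hy', a, ha, b, hb, hne', hq'⟩ := quot9 X hinf hneg _ hq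
    obtain ⟨e, he, w, hw, h⟩ := hAE (show c * (x + y)⁻¹ ∈ algN X 2 from
      ⟨_, sums9 X _ _ (hp1 a ha) (hp1 b hb), _, sums9 X _ _ (hp1 x' hx') (hp1 y' hy'), hne', hq'⟩)
    have h' : e + w = c * (x + y)⁻¹ := h
    have heK : e ∈ K := by
      have : e = c * (x + y)⁻¹ - w := by linear_combination h'
      rw [this]
      exact K.sub_mem hq (hXK w hw)
    obtain ⟨p, hp, r, hr, hpr⟩ := ht e ⟨he, heK⟩
    have hc' : c = (p + r + 0 + 0) + w * (x + y + 0 + 0) := by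
      have : c = (x + y) * (e + w) := by
        rw [h']
        field_simp
      rw [this]
      linear_combination hpr
    rw [hc']
    exact Set.add_mem_add
      (Set.add_mem_add (Set.add_mem_add (Set.add_mem_add hp hr) h0) h0)
      (Set.mul_mem_mul hw (Set.add_mem_add (Set.add_mem_add (Set.add_mem_add hx hy) h0) h0))
  · have h4 : ∀ z ∈ X + X + X + X, z ∈ K := by
      rintro _ ⟨_, ⟨_, ⟨a, ha, b, hb, rfl⟩, c, hc, rfl⟩, d, hd, rfl⟩
      exact K.add_mem (K.add_mem (K.add_mem (hXK a ha) (hXK b hb)) (hXK c hc)) (hXK d hd)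
    rintro _ ⟨u, hu, _, ⟨x, hx, v, hv, rfl⟩, rfl⟩
    exact K.add_mem (h4 u hu) (K.mul_mem (hXK x hx) (h4 v hv))
end

section
/- Let F be an infinite field and X ⊆ F an additively symmetric subset which is generic, i.e. F is covered by finitely many additive translates of X. Then 4X + X·4X = F. -/
open Pointwise

universe u

/-- If `F` is an infinite field and `X ⊆ F` is additively symmetric and generic (finitely
many additive translates of `X` cover `F`), then `4X + X·4X = F`. -/
theorem stmt10 {F : Type u} [Field F] [Infinite F] (X : Set F) (hsym : AddSymm X)
    (hgen : ∃ F₀ : Set F, F₀.Finite ∧ F₀ + X = Set.univ) :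
    (X + X + X + X) + X * (X + X + X + X) = Set.univ := by
  classical
  obtain ⟨h0, hneg⟩ := hsym
  obtain ⟨F₀, hfin, hcov⟩ := hgen
  have neg : ∀ x ∈ X, -x ∈ X := by
    intro x hx
    rw [hneg] at hx
    exact hx
  have hXinf : X.Infinite := by
    intro hX
    have h := hfin.add hX
    rw [hcov] at h
    exact Set.infinite_univ h
  have cov : ∀ y : F, ∃ f : F₀, y - f ∈ X := by
    intro y
    have hy : y ∈ F₀ + X := by rw [hcov]; trivial
    obtain ⟨f, hf, x, hx, rfl⟩ := Set.mem_add.1 hy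
    exact ⟨⟨f, hf⟩, by simpa using hx⟩
  choose g hg using cov
  haveI : Finite F₀ := hfin
  haveI : Infinite X := hXinf.to_subtype
  let c : X → (Set F₀) × (F₀ → F₀) := fun x =>
    ({f : F₀ | ∃ r ∈ X, ∃ s ∈ X, (f : F) = r + x * s}, fun f => g (x * f))
  obtain ⟨x, x', hne, hc⟩ := Finite.exists_ne_map_eq_of_infinite c
  have hc1 := congrArg Prod.fst hc
  have hc2 := congrArg Prod.snd hc
  have hd : (x : F) - x' ≠ 0 := fun h => hne (Subtype.ext (sub_eq_zero.1 h))
  rw [Set.eq_univ_iff_forall]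
  intro y
  set f := g (y / ((x : F) - x')) with hf
  have hu := hg (y / ((x : F) - x'))
  rw [← hf] at hu
  obtain ⟨u, hue⟩ : ∃ u, u = y / ((x : F) - x') - f := ⟨_, rfl⟩
  rw [← hue] at hu
  have hy : y = ((x : F) - x') * (f + u) := by
    rw [hue]; field_simp; ring
  have hp := hg (x * f)
  have hp' := hg (x' * f)
  have e : g (x * f) = g (x' * f) := congrFun hc2 f
  rw [← e] at hp'
  have hq := hg (x * u)
  have hm : g (x * u) ∈ (c x).1 :=
    ⟨-(x * u - g (x * u)), neg _ hq, u, hu, by ring⟩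
  rw [hc1] at hm
  obtain ⟨r, hr, s, hs, hrs⟩ := hm
  have hs' := Set.add_mem_add (Set.add_mem_add (Set.add_mem_add hs (neg _ hu)) h0) h0
  have ha := Set.add_mem_add (Set.add_mem_add (Set.add_mem_add hp (neg _ hp')) hq) hr
  have := Set.add_mem_add ha (Set.mul_mem_mul x'.2 hs')
  convert this using 1
  rw [hy]
  linear_combination hrs
end
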